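/- For a symmetric positive definite 2n×2n real matrix H and a nondecreasing n-tuple ν = (ν₁ ≤ … ≤ νₙ) of positive real numbers, write F(H) = ν if there exists S ∈ Sp(2n,ℝ) with SᵀHS = diag(ν₁, …, νₙ, ν₁, …, νₙ) (the νⱼ are the frequencies of the normal modes of the linear Hamiltonian system generated by H). Then for any nondecreasing n-tuples λ and μ of positive real numbers, the set { ν ∈ ℝⁿ : ν = F(H₁ + H₂) for some symmetric positive definite H₁, H₂ with F(H₁) = λ and F(H₂) = μ } is a closed convex subset of ℝⁿ. -/

import Mathlib

open Matrix

/-- The standard symplectic form matrix `Ω = [[0, Iₙ], [-Iₙ, 0]]` on `ℝ²ⁿ`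
(coordinates indexed by `Fin n ⊕ Fin n`). -/
noncomputable def Omega (n : ℕ) : Matrix (Fin n ⊕ Fin n) (Fin n ⊕ Fin n) ℝ :=
  Matrix.fromBlocks 0 1 (-1) 0

/-- The real symplectic group `Sp(2n, ℝ) = {S : Sᵀ Ω S = Ω}`. -/
noncomputable def Sp (n : ℕ) : Set (Matrix (Fin n ⊕ Fin n) (Fin n ⊕ Fin n) ℝ) :=
  {S | Sᵀ * Omega n * S = Omega n}

/-- The symplectic Lie algebra `sp(2n, ℝ) = {X : Xᵀ Ω + Ω X = 0}`. -/
noncomputable def sp (n : ℕ) : Set (Matrix (Fin n ⊕ Fin n) (Fin n ⊕ Fin n) ℝ) :=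
  {X | Xᵀ * Omega n + Omega n * X = 0}

/-- `hasFrequencies n H ν` means the positive definite quadratic Hamiltonian `H` has
normal-mode frequencies `ν`: some `S ∈ Sp(2n,ℝ)` brings `H` to the Williamson normal
form `diag(ν₁, …, νₙ, ν₁, …, νₙ)`. -/
noncomputable def hasFrequencies (n : ℕ)
    (H : Matrix (Fin n ⊕ Fin n) (Fin n ⊕ Fin n) ℝ) (nu : Fin n → ℝ) : Prop :=
  ∃ S ∈ Sp n, Sᵀ * H * S = Matrix.diagonal (Sum.elim nu nu)

section Williamson

open scoped ComplexOrder Topology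

section MinorExpansion

variable {m κ : Type*} [Fintype m] [DecidableEq m] [Fintype κ] [DecidableEq κ]

omit [DecidableEq m] in
theorem det_mul_eq_sum_fun (B : Matrix κ m ℂ) (A : Matrix m κ ℂ) :
    (B * A).det = ∑ f : κ → m, (∏ j, B j (f j)) * (A.submatrix f id).det := by
  have h : (B * A : Matrix κ κ ℂ) = fun j => ∑ p, B j p • A p := by
    ext j l; simp [Matrix.mul_apply, Finset.sum_apply]
  have h2 := (detRowAlternating (n := κ) (R := ℂ)).toMultilinearMap.map_sum
    (g := fun j p => B j p • A p)
  have h3 : (B * A).det = (detRowAlternating (n := κ) (R := ℂ)).toMultilinearMap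
      (fun j => ∑ p, B j p • A p) := by rw [h]; rfl
  rw [h3, h2]
  refine Finset.sum_congr rfl fun f _ => ?_
  rw [MultilinearMap.map_smul_univ]
  rfl

theorem factorial_mul_det_conjTranspose_mul (A : Matrix m κ ℂ) (d : m → ℂ) :
    ((Fintype.card κ).factorial : ℂ) * (Aᴴ * diagonal d * A).det =
      ∑ f : κ → m, (∏ j, d (f j)) * (star (A.submatrix f id).det * (A.submatrix f id).det) := by
  have h1 : ∀ τ : Equiv.Perm κ, (Aᴴ * diagonal d * A).det =
      ∑ f : κ → m, (∏ j, d (f j)) * (((Equiv.Perm.sign τ : ℤ) * ∏ j, star (A (f (τ j)) j)) *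
        (A.submatrix f id).det) := by
    intro τ
    rw [det_mul_eq_sum_fun, ← (Equiv.arrowCongr τ.symm (Equiv.refl m)).sum_comp]
    refine Finset.sum_congr rfl fun f _ => ?_
    have e1 : (A.submatrix (Equiv.arrowCongr τ.symm (Equiv.refl m) f) id).det =
        (Equiv.Perm.sign τ : ℤ) * (A.submatrix f id).det := by
      rw [← Matrix.det_permute τ]; rfl
    have e2 : ∏ j, d (f (τ j)) = ∏ j, d (f j) := Equiv.prod_comp τ (fun j => d (f j))
    rw [e1]
    simp only [mul_diagonal, conjTranspose_apply, Equiv.arrowCongr_apply, Finset.prod_mul_distrib,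
      Function.comp_apply, Equiv.symm_symm, Equiv.refl_apply]
    rw [e2]; ring
  have h2 := Finset.sum_congr (rfl : (Finset.univ : Finset (Equiv.Perm κ)) = _) fun τ _ => h1 τ
  rw [Finset.sum_const, Finset.card_univ, Fintype.card_perm, nsmul_eq_mul] at h2
  rw [h2, Finset.sum_comm]
  refine Finset.sum_congr rfl fun f _ => ?_
  rw [← Finset.mul_sum, ← Finset.sum_mul]
  congr 2
  rw [Matrix.det_apply, star_sum]
  refine Finset.sum_congr rfl fun τ _ => ?_
  simp [Units.smul_def, zsmul_eq_mul]

theorem factorial_mul_re_det_conjTranspose_mul (A : Matrix m κ ℂ) (d : m → ℝ) :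
    ((Fintype.card κ).factorial : ℝ) * (Aᴴ * diagonal (fun p => (d p : ℂ)) * A).det.re =
      ∑ f : κ → m, (∏ j, d (f j)) * ‖(A.submatrix f id).det‖ ^ 2 := by
  have h := congrArg Complex.re (factorial_mul_det_conjTranspose_mul A (fun p => (d p : ℂ)))
  rw [Complex.re_sum] at h
  have e : ((Fintype.card κ).factorial : ℂ) = (((Fintype.card κ).factorial : ℝ) : ℂ) := by simp
  rw [e, Complex.re_ofReal_mul] at h
  rw [h]
  refine Finset.sum_congr rfl fun f _ => ?_
  rw [← Complex.ofReal_prod, Complex.re_ofReal_mul]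
  congr 1
  rw [Complex.star_def, ← Complex.normSq_eq_conj_mul_self, Complex.ofReal_re,
    Complex.normSq_eq_norm_sq]

theorem prod_mul_norm_det_sq_le (A : Matrix m κ ℂ) (d : m → ℝ) (hd : ∀ p, 0 ≤ d p) (f : κ → m) :
    (∏ j, d (f j)) * ‖(A.submatrix f id).det‖ ^ 2 ≤ ((Fintype.card κ).factorial : ℝ) *
      (Aᴴ * diagonal (fun p => (d p : ℂ)) * A).det.re := by
  rw [factorial_mul_re_det_conjTranspose_mul]
  exact Finset.single_le_sum (f := fun f : κ → m => (∏ j, d (f j)) * ‖(A.submatrix f id).det‖ ^ 2)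
    (fun f _ => mul_nonneg (Finset.prod_nonneg fun j _ => hd _) (sq_nonneg _)) (Finset.mem_univ f)

theorem exists_det_submatrix_ne_zero (A : Matrix m κ ℂ) (hA : (Aᴴ * A).det ≠ 0) :
    ∃ f : κ → m, (A.submatrix f id).det ≠ 0 := by
  by_contra! h
  have h1 := factorial_mul_det_conjTranspose_mul A (fun _ => 1)
  simp only [h, mul_zero, Finset.sum_const_zero, mul_eq_zero, Nat.cast_eq_zero] at h1
  rcases h1 with h1 | h1
  · exact (Nat.factorial_pos _).ne' h1
  · apply hA
    rwa [show diagonal (fun _ : m => (1 : ℂ)) = 1 from diagonal_one, Matrix.mul_one] at h1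

/-- A basis of rows of maximal weight is maximal for every superlevel set of the weight. -/
theorem exists_greedy_rows (A : Matrix m κ ℂ) (hA : (Aᴴ * A).det ≠ 0) (x : m → ℝ) :
    ∃ f : κ → m, (A.submatrix f id).det ≠ 0 ∧ ∀ S : Finset m, (∀ p ∈ S, ∀ q ∉ S, x q < x p) →
      (diagonal (fun p => if p ∈ S then (1 : ℂ) else 0) * A).rank ≤
        (Finset.univ.filter fun j => f j ∈ S).card := by
  classical
  obtain ⟨f0, hf0⟩ := exists_det_submatrix_ne_zero A hA
  obtain ⟨f, hf, hmax⟩ := Finset.exists_max_image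
    (Finset.univ.filter fun f : κ → m => (A.submatrix f id).det ≠ 0) (fun f => ∑ j, x (f j))
    ⟨f0, by simpa using hf0⟩
  simp only [Finset.mem_filter, Finset.mem_univ, true_and] at hf hmax
  refine ⟨f, hf, fun S hS => ?_⟩
  set D : Matrix m m ℂ := diagonal (fun p => if p ∈ S then (1 : ℂ) else 0) with hD
  set B := A.submatrix f id with hB
  have hBu : IsUnit B.det := hf.isUnit
  set C := A * B⁻¹ with hC
  have hCB : C * B = A := by rw [hC, Matrix.mul_assoc, Matrix.nonsing_inv_mul _ hBu, Matrix.mul_one]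
  set E : Matrix κ κ ℂ := diagonal (fun j => if f j ∈ S then (1 : ℂ) else 0) with hE
  have hzero : ∀ p ∈ S, ∀ j, f j ∉ S → C p j = 0 := by
    intro p hp j hj
    by_contra hc
    have hrow : A p = ∑ l, C p l • B l := by
      ext i
      conv_lhs => rw [← hCB]
      simp [Matrix.mul_apply, Finset.sum_apply]
    have hdet : (A.submatrix (Function.update f j p) id).det = C p j * B.det := by
      have : A.submatrix (Function.update f j p) id = B.updateRow j (∑ l, C p l • B l) := by
        rw [← hrow]
        ext l i
        by_cases hl : l = j
        · subst hl; simp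
        · simp [hl, hB]
      rw [this, Matrix.det_updateRow_sum, smul_eq_mul]
    have hle := hmax (Function.update f j p) (by rw [hdet]; exact mul_ne_zero hc hf)
    have hlt : ∑ l, x (f l) < ∑ l, x (Function.update f j p l) := by
      apply Finset.sum_lt_sum
      · intro l _
        by_cases hl : l = j
        · subst hl; simpa using (hS p hp _ hj).le
        · simp [hl]
      · exact ⟨j, Finset.mem_univ _, by simpa using hS p hp _ hj⟩
    linarith
  have hfac : D * A = D * C * E * B := by
    have : D * C * E = D * C := by
      ext p j
      rw [hE, mul_diagonal, hD, diagonal_mul]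
      by_cases hp : p ∈ S
      · by_cases hj : f j ∈ S
        · simp [hj]
        · simp [hj, hzero p hp j hj]
      · simp [hp]
    rw [this, Matrix.mul_assoc, hCB]
  calc (D * A).rank ≤ (D * C * E).rank := by rw [hfac]; exact rank_mul_le_left _ _
    _ ≤ E.rank := rank_mul_le_right _ _
    _ = _ := by
      rw [hE, rank_diagonal, Fintype.card_subtype]
      congr 1
      ext j; simp

end MinorExpansion

/-- If the superlevel sums of `a` and `b` are ordered, and both have the same total, then
weighted sums are ordered. -/
theorem sum_nonneg_of_levelSums_nonneg {σ : Type*} [Fintype σ] (a x : σ → ℝ)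
    (h : ∀ s : ℝ, 0 ≤ ∑ j, if s ≤ x j then a j else 0) (h0 : ∑ j, a j = 0) :
    0 ≤ ∑ j, a j * x j := by
  classical
  obtain ⟨b, hb⟩ : ∃ b, ∀ j, b ≤ x j := by
    obtain ⟨b, hb⟩ := (Set.finite_range x).bddBelow
    exact ⟨b, fun j => hb ⟨j, rfl⟩⟩
  obtain ⟨B, hB⟩ : ∃ b, ∀ j, x j ≤ b := by
    obtain ⟨b, hb⟩ := (Set.finite_range x).bddAbove
    exact ⟨b, fun j => hb ⟨j, rfl⟩⟩
  have h_integrable : ∀ j, MeasureTheory.Integrable (fun s => if s ≤ x j then a j else 0)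
      (MeasureTheory.volume.restrict (Set.Ioc b B)) := by
    intro j
    have : (fun s => if s ≤ x j then a j else 0) = (Set.Iic (x j)).indicator (fun _ => a j) := by
      ext s; simp [Set.indicator_apply]
    rw [this]
    exact (MeasureTheory.integrable_const _).indicator measurableSet_Iic
  have e : ∀ j, ∫ s in Set.Ioc b B, (if s ≤ x j then a j else 0) = a j * (x j - b) := by
    intro j
    have : (fun s => if s ≤ x j then a j else 0) = (Set.Iic (x j)).indicator (fun _ => a j) := by
      ext s; simp [Set.indicator_apply]
    rw [this, MeasureTheory.setIntegral_indicator measurableSet_Iic, Set.Ioc_inter_Iic,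
      min_eq_right (hB j), MeasureTheory.setIntegral_const, smul_eq_mul,
      Real.volume_real_Ioc_of_le (hb j), mul_comm]
  have : ∑ j, a j * x j = ∫ s in Set.Ioc b B, ∑ j, if s ≤ x j then a j else 0 := by
    rw [MeasureTheory.integral_finsetSum _ fun j _ => h_integrable j]
    simp only [e, mul_sub, Finset.sum_sub_distrib, ← Finset.sum_mul, h0]
    ring
  rw [this]
  exact MeasureTheory.integral_nonneg fun s => h s

section BlockDiag

variable {α R : Type*} [Fintype α] [DecidableEq α]

/-- The projection onto the first summand. -/
def firstProj (α R : Type*) [DecidableEq α] [Zero R] [One R] :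
    Matrix (α ⊕ α) (α ⊕ α) R :=
  diagonal (Sum.elim (fun _ => 1) (fun _ => 0))

/-- Block diagonal matrices with respect to the two summands of the index type. -/
def IsBD [NonAssocSemiring R] (A : Matrix (α ⊕ α) (α ⊕ α) R) : Prop :=
  firstProj α R * A = A * firstProj α R

theorem isBD_iff [NonAssocSemiring R] (A : Matrix (α ⊕ α) (α ⊕ α) R) :
    IsBD A ↔ ∀ p q, p.isLeft ≠ q.isLeft → A p q = 0 := by
  rw [IsBD, firstProj, ← Matrix.ext_iff]
  simp only [diagonal_mul, mul_diagonal]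
  constructor
  · rintro h (p | p) (q | q) hpq
    · simp at hpq
    · simpa using h (.inl p) (.inr q)
    · simpa using (h (.inr p) (.inl q)).symm
    · simp at hpq
  · rintro h (p | p) (q | q)
    · simp
    · simp [h (.inl p) (.inr q) (by simp)]
    · simp [h (.inr p) (.inl q) (by simp)]
    · simp

theorem isBD_fromBlocks [NonAssocSemiring R] (A B : Matrix α α R) : IsBD (fromBlocks A 0 0 B) := by
  rw [isBD_iff]
  rintro (p | p) (q | q) h <;> simp_all

theorem IsBD.mul [Semiring R] {A B : Matrix (α ⊕ α) (α ⊕ α) R} (hA : IsBD A) (hB : IsBD B) :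
    IsBD (A * B) := by
  unfold IsBD at *
  rw [← Matrix.mul_assoc, hA, Matrix.mul_assoc, hB, Matrix.mul_assoc]

theorem IsBD.one [Semiring R] : IsBD (1 : Matrix (α ⊕ α) (α ⊕ α) R) := by simp [IsBD]

theorem IsBD.sub [Ring R] {A B : Matrix (α ⊕ α) (α ⊕ α) R} (hA : IsBD A) (hB : IsBD B) :
    IsBD (A - B) := by
  unfold IsBD at *
  rw [Matrix.mul_sub, Matrix.sub_mul, hA, hB]

theorem IsBD.add [Ring R] {A B : Matrix (α ⊕ α) (α ⊕ α) R} (hA : IsBD A) (hB : IsBD B) :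
    IsBD (A + B) := by
  unfold IsBD at *
  rw [Matrix.mul_add, Matrix.add_mul, hA, hB]

theorem IsBD.diagonal [Semiring R] (d : α ⊕ α → R) : IsBD (diagonal d) := by
  rw [isBD_iff]
  intro p q h
  exact diagonal_apply_ne _ (fun e => h (by rw [e]))

theorem IsBD.conjTranspose [Semiring R] [StarRing R] {A : Matrix (α ⊕ α) (α ⊕ α) R}
    (hA : IsBD A) : IsBD Aᴴ := by
  rw [isBD_iff] at *
  intro p q h
  rw [conjTranspose_apply, hA q p h.symm, star_zero]

theorem IsBD.map {S : Type*} [Semiring R] [Semiring S] {A : Matrix (α ⊕ α) (α ⊕ α) R}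
    (hA : IsBD A) (f : R →+* S) : IsBD (A.map f) := by
  rw [isBD_iff] at *
  intro p q h
  rw [map_apply, hA p q h, map_zero]

theorem IsBD.inv [Field R] {A : Matrix (α ⊕ α) (α ⊕ α) R} (hA : IsBD A) (hu : IsUnit A.det) :
    IsBD A⁻¹ := by
  unfold IsBD at *
  have := congrArg (fun X => A⁻¹ * X * A⁻¹) hA
  simp only [Matrix.mul_assoc, Matrix.mul_nonsing_inv _ hu, Matrix.mul_one] at this
  rw [← Matrix.mul_assoc A⁻¹ A, Matrix.nonsing_inv_mul _ hu, Matrix.one_mul] at this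
  exact this.symm

end BlockDiag

section Rank

variable {m κ : Type*} [Fintype m] [Fintype κ]

omit [Fintype m] in
theorem exists_rank_factorization {K : Type*} [Field K] (A : Matrix m κ K) :
    ∃ (B : Matrix m (Fin A.rank) K) (C : Matrix (Fin A.rank) κ K), A = B * C := by
  classical
  let b : Module.Basis (Fin A.rank) K (LinearMap.range A.mulVecLin) := Module.finBasis K _
  refine ⟨of fun i r => (b r : m → K) i,
    of fun r j => b.repr ⟨A.mulVecLin (Pi.single j 1), LinearMap.mem_range_self _ _⟩ r, ?_⟩
  ext i j
  have h := b.sum_repr ⟨A.mulVecLin (Pi.single j 1), LinearMap.mem_range_self _ _⟩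
  have h2 := congrFun (congrArg Subtype.val h) i
  simp only [Submodule.coe_sum, Submodule.coe_smul, Finset.sum_apply, Pi.smul_apply,
    smul_eq_mul, mulVecLin_apply, mulVec_single_one, col_apply] at h2
  rw [← h2, Matrix.mul_apply]
  exact Finset.sum_congr rfl fun r _ => by simp [mul_comm]

omit [Fintype m] in
theorem rank_map_ringHom_le {K L : Type*} [Field K] [Field L] (σ : K →+* L) (A : Matrix m κ K) :
    (A.map σ).rank ≤ A.rank := by
  obtain ⟨B, C, h⟩ := exists_rank_factorization A
  have : A.map σ = B.map σ * C.map σ := by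
    conv_lhs => rw [h]
    exact Matrix.map_mul
  rw [this]
  exact (rank_mul_le_left _ _).trans ((rank_le_card_width _).trans (by simp))

variable [DecidableEq κ]

theorem re_trace_le_rank (B : Matrix m κ ℂ) (h : (1 - Bᴴ * B).PosSemidef) :
    (Bᴴ * B).trace.re ≤ B.rank := by
  have hH : (Bᴴ * B).IsHermitian := isHermitian_conjTranspose_mul_self B
  rw [← rank_conjTranspose_mul_self, hH.rank_eq_card_non_zero_eigs, hH.trace_eq_sum_eigenvalues,
    Complex.re_sum, Fintype.card_subtype, Finset.card_eq_sum_ones, Nat.cast_sum,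
    Finset.sum_filter]
  refine Finset.sum_le_sum fun i _ => ?_
  simp only [Nat.cast_one, ne_eq, ite_not]
  split_ifs with h0
  · simp [h0]
  · have h1 := h.dotProduct_mulVec_nonneg (hH.eigenvectorBasis i)
    have h2 := hH.mulVec_eigenvectorBasis i
    rw [Matrix.sub_mulVec, one_mulVec, h2, dotProduct_sub, dotProduct_smul] at h1
    have h3 : star (hH.eigenvectorBasis i : κ → ℂ) ⬝ᵥ (hH.eigenvectorBasis i : κ → ℂ) = 1 := by
      have := (orthonormal_iff_ite.mp hH.eigenvectorBasis.orthonormal) i i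
      rw [if_pos rfl, EuclideanSpace.inner_eq_star_dotProduct, dotProduct_comm] at this
      exact this
    rw [h3] at h1
    have h4 := (Complex.le_def.mp h1).1
    simp at h4
    simpa using h4

end Rank

theorem exists_hermitian_of_idempotent {α : Type*} [Fintype α] [DecidableEq α]
    (P : Matrix (α ⊕ α) (α ⊕ α) ℂ) (hP : P * P = P) (hb : IsBD P) :
    ∃ Q : Matrix (α ⊕ α) (α ⊕ α) ℂ, Qᴴ = Q ∧ Q * Q = Q ∧ IsBD Q ∧ P * Q = Q ∧ Q * P = P := by
  set X := P + Pᴴ - 1 with hX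
  have hPH : Pᴴ * Pᴴ = Pᴴ := by rw [← conjTranspose_mul, hP]
  have hXX : X * X = 1 + (P - Pᴴ) * (P - Pᴴ)ᴴ := by
    rw [hX, conjTranspose_sub, conjTranspose_conjTranspose]
    noncomm_ring
    rw [hP, hPH]
    abel
  have hdet : IsUnit X.det := by
    have h1 : (X * X).PosDef := by
      rw [hXX]
      exact PosDef.one.add_posSemidef (posSemidef_self_mul_conjTranspose _)
    have h2 := h1.det_pos.ne'
    rw [det_mul] at h2
    exact (left_ne_zero_of_mul h2).isUnit
  have hXH : Xᴴ = X := by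
    rw [hX]; simp [add_comm]
  have hXP : X * P = Pᴴ * X := by
    rw [hX]
    noncomm_ring
    rw [hP, hPH]
    abel
  have hQ : P * X⁻¹ = X⁻¹ * Pᴴ := by
    have := congrArg (fun Y => X⁻¹ * Y * X⁻¹) hXP
    simp only [Matrix.mul_assoc, Matrix.mul_nonsing_inv _ hdet, Matrix.mul_one] at this
    rw [← this, ← Matrix.mul_assoc, Matrix.nonsing_inv_mul _ hdet, Matrix.one_mul]
  have hPQ : P * (P * X⁻¹) = P * X⁻¹ := by rw [← Matrix.mul_assoc, hP]
  have hQP : P * X⁻¹ * P = P := by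
    have : Pᴴ * P = X * P := by
      rw [hXP, hX]
      noncomm_ring
      rw [hPH]
      abel
    rw [hQ, Matrix.mul_assoc, this, ← Matrix.mul_assoc, Matrix.nonsing_inv_mul _ hdet,
      Matrix.one_mul]
  refine ⟨P * X⁻¹, ?_, ?_, hb.mul (IsBD.inv ((hb.add hb.conjTranspose).sub IsBD.one) hdet), hPQ,
    hQP⟩
  · rw [conjTranspose_mul, conjTranspose_nonsing_inv, hXH, hQ]
  · rw [← Matrix.mul_assoc, hQP]

section Compactness

variable {m κ : Type*} [Fintype m] [Fintype κ]

theorem isOpen_le_rank (r : ℕ) : IsOpen {A : Matrix m κ ℂ | r ≤ A.rank} := by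
  classical
  let φ : Matrix m κ ℂ →ₗ[ℂ] ((κ → ℂ) →L[ℂ] (m → ℂ)) :=
    LinearMap.toContinuousLinearMap.toLinearMap ∘ₗ (Matrix.toLin' (R := ℂ)).toLinearMap
  have hφ : Continuous φ := LinearMap.continuous_of_finiteDimensional φ
  have := (isOpen_setOfPred_nat_le_rank (𝕜 := ℂ) (E := κ → ℂ) (F := m → ℂ) r).preimage hφ
  convert this using 1
  ext A
  change r ≤ A.rank ↔ (r : Cardinal) ≤ (Matrix.toLin' A).rank
  rw [← Nat.cast_le (α := Cardinal), Matrix.rank, Module.finrank_eq_rank]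
  rfl

omit [Fintype m] [Fintype κ] in
theorem isCompact_setOf_norm_apply_le {𝕜 : Type*} [RCLike 𝕜] (c : ℝ) :
    IsCompact {A : Matrix m κ 𝕜 | ∀ i j, ‖A i j‖ ≤ c} := by
  have h := isCompact_univ_pi (X := fun _ : m => κ → 𝕜) fun _ =>
    isCompact_univ_pi fun _ : κ => isCompact_closedBall (0 : 𝕜) c
  have e : {A : Matrix m κ 𝕜 | ∀ i j, ‖A i j‖ ≤ c} =
      Set.univ.pi (fun _ : m => Set.univ.pi fun _ : κ => Metric.closedBall (0 : 𝕜) c) := by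
    refine Set.ext fun A => ?_
    change (∀ i j, ‖A i j‖ ≤ c) ↔ (fun i j => A i j : m → κ → 𝕜) ∈ Set.univ.pi _
    simp only [Set.mem_univ_pi, mem_closedBall_zero_iff]
  rw [e]
  exact h

omit [Fintype κ] in
theorem norm_apply_le_one_of_diag {𝕜 : Type*} [RCLike 𝕜] (A : Matrix m κ 𝕜)
    (h : ∀ j, (Aᴴ * A) j j = 1) (i : m) (j : κ) : ‖A i j‖ ≤ 1 := by
  have h1 := congrArg RCLike.re (h j)
  simp only [Matrix.mul_apply, conjTranspose_apply, RCLike.star_def, RCLike.conj_mul, map_sum,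
    RCLike.one_re] at h1
  have h3 : ‖A i j‖ ^ 2 ≤ 1 := by
    rw [← h1]
    refine le_trans (le_of_eq ?_) (Finset.single_le_sum
      (f := fun i => RCLike.re ((‖A i j‖ : 𝕜) ^ 2)) (fun k _ => ?_) (Finset.mem_univ i))
    · rw [← RCLike.ofReal_pow, RCLike.ofReal_re]
    · rw [← RCLike.ofReal_pow, RCLike.ofReal_re]; positivity
  nlinarith [norm_nonneg (A i j)]

theorem isCompact_projections (m : Type*) [Fintype m] [DecidableEq m] :
    IsCompact {P : Matrix m m ℂ | Pᴴ = P ∧ P * P = P} := by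
  refine (isCompact_setOf_norm_apply_le (m := m) (κ := m) (𝕜 := ℂ) 1).of_isClosed_subset ?_ ?_
  · exact (isClosed_eq (by fun_prop) continuous_id).inter
      (isClosed_eq (by fun_prop) continuous_id)
  · rintro P ⟨h1, h2⟩ i j
    have h3 : P j j = ∑ k, (‖P k j‖ ^ 2 : ℝ) := by
      conv_lhs => rw [← h2]
      rw [Matrix.mul_apply, Complex.ofReal_sum]
      refine Finset.sum_congr rfl fun k _ => ?_
      conv_lhs => rw [← h1]
      rw [conjTranspose_apply, h1]
      rw [Complex.star_def, ← Complex.normSq_eq_conj_mul_self, Complex.normSq_eq_norm_sq]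
    have h4 : ‖P j j‖ = ∑ k, ‖P k j‖ ^ 2 := by
      rw [h3, Complex.norm_real, Real.norm_of_nonneg (by positivity)]
    have h5 : ∀ k, ‖P k j‖ ^ 2 ≤ ‖P j j‖ := fun k => by
      rw [h4]
      exact Finset.single_le_sum (f := fun k => ‖P k j‖ ^ 2) (fun _ _ => by positivity)
        (Finset.mem_univ k)
    have h6 : ‖P j j‖ ≤ 1 := by nlinarith [h5 j, norm_nonneg (P j j)]
    nlinarith [h5 i, norm_nonneg (P i j)]

end Compactness

section Semistable

variable {α I : Type*} [Fintype α] [DecidableEq α] [Fintype I] {κ : I → Type*}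
  [∀ i, Fintype (κ i)]

/-- Weighted slope inequality for a family of subspaces (column spaces of `T i`), tested on
block diagonal idempotents. -/
def Semistable (T : ∀ i, Matrix (α ⊕ α) (κ i) ℂ) (w : I → ℝ) : Prop :=
  ∀ P : Matrix (α ⊕ α) (α ⊕ α) ℂ, P * P = P → IsBD P →
    ∑ i, w i * Fintype.card (κ i) ≤
      ∑ i, w i * (((1 - P) * T i).rank + ((T i)ᵀ * P).rank : ℕ)

theorem Semistable.of_hermitian {T : ∀ i, Matrix (α ⊕ α) (κ i) ℂ} {w : I → ℝ}
    (hw : ∀ i, 0 ≤ w i)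
    (h : ∀ P : Matrix (α ⊕ α) (α ⊕ α) ℂ, Pᴴ = P → P * P = P → IsBD P →
      ∑ i, w i * Fintype.card (κ i) ≤
        ∑ i, w i * (((1 - P) * T i).rank + ((T i)ᵀ * P).rank : ℕ)) : Semistable T w := by
  intro P hP hb
  obtain ⟨Q, hQH, hQQ, hQb, hPQ, hQP⟩ := exists_hermitian_of_idempotent P hP hb
  refine (h Q hQH hQQ hQb).trans ?_
  refine Finset.sum_le_sum fun i _ => mul_le_mul_of_nonneg_left ?_ (hw i)
  have h1 : (1 - Q) * T i = (1 - Q) * ((1 - P) * T i) := by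
    rw [← Matrix.mul_assoc]
    congr 1
    rw [Matrix.sub_mul, Matrix.mul_sub, Matrix.mul_sub, hQP]
    simp
  have h2 : (T i)ᵀ * Q = (T i)ᵀ * P * Q := by rw [Matrix.mul_assoc, hPQ]
  have h3 : ((1 - Q) * T i).rank ≤ ((1 - P) * T i).rank := by
    rw [h1]; exact rank_mul_le_right _ _
  have h4 : ((T i)ᵀ * Q).rank ≤ ((T i)ᵀ * P).rank := by
    rw [h2]; exact rank_mul_le_left _ _
  exact Nat.cast_le.mpr (add_le_add h3 h4)

theorem Semistable.linear {T : ∀ i, Matrix (α ⊕ α) (κ i) ℂ} {w w' : I → ℝ}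
    (h : Semistable T w) (h' : Semistable T w') {a b : ℝ} (ha : 0 ≤ a) (hb : 0 ≤ b) :
    Semistable T (fun i => a * w i + b * w' i) := by
  intro P hP hbd
  have h1 := mul_le_mul_of_nonneg_left (h P hP hbd) ha
  have h2 := mul_le_mul_of_nonneg_left (h' P hP hbd) hb
  simp only [add_mul, Finset.sum_add_distrib, mul_assoc, ← Finset.mul_sum]
  exact add_le_add h1 h2

theorem Semistable.of_map {T T' : ∀ i, Matrix (α ⊕ α) (κ i) ℂ} {w : I → ℝ} (hw : ∀ i, 0 ≤ w i)
    (h : Semistable T' w) (σ : ℂ →+* ℂ) (hσ : ∀ i, (T i).map σ = T' i) : Semistable T w := by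
  intro P hP hbd
  refine (h (P.map σ) ?_ (hbd.map σ)).trans ?_
  · rw [← Matrix.map_mul, hP]
  · refine Finset.sum_le_sum fun i _ => mul_le_mul_of_nonneg_left ?_ (hw i)
    have h1 : (1 - P.map σ) * T' i = ((1 - P) * T i).map σ := by
      rw [Matrix.map_mul, ← hσ, Matrix.map_sub _ (map_sub σ), Matrix.map_one _ (map_zero σ)
        (map_one σ)]
    have h2 : (T' i)ᵀ * P.map σ = ((T i)ᵀ * P).map σ := by
      rw [Matrix.map_mul, ← hσ, transpose_map]
    rw [h1, h2]
    exact_mod_cast add_le_add (rank_map_ringHom_le _ _) (rank_map_ringHom_le _ _)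

theorem Semistable.eventually {X : Type*} [TopologicalSpace X]
    {T : X → ∀ i, Matrix (α ⊕ α) (κ i) ℂ} {w : I → ℝ} (hw : ∀ i, 0 ≤ w i)
    (hT : ∀ i, Continuous fun x => T x i) {a : X} (h : Semistable (T a) w) :
    ∀ᶠ x in 𝓝 a, Semistable (T x) w := by
  have hK : IsCompact {P : Matrix (α ⊕ α) (α ⊕ α) ℂ | (Pᴴ = P ∧ P * P = P) ∧ IsBD P} := by
    refine (isCompact_projections (α ⊕ α)).inter_right ?_
    exact isClosed_eq (by fun_prop) (by fun_prop)
  have key := hK.eventually_forall_of_forall_eventually (x₀ := a)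
    (P := fun x P => ∑ i, w i * Fintype.card (κ i) ≤
      ∑ i, w i * (((1 - P) * T x i).rank + ((T x i)ᵀ * P).rank : ℕ)) ?_
  · filter_upwards [key] with x hx
    exact Semistable.of_hermitian hw fun P h1 h2 h3 => hx P ⟨⟨h1, h2⟩, h3⟩
  · rintro P ⟨⟨_, hPP⟩, hPb⟩
    have e1 : ∀ i, ∀ᶠ z : X × Matrix (α ⊕ α) (α ⊕ α) ℂ in 𝓝 (a, P),
        ((1 - P) * T a i).rank ≤ ((1 - z.2) * T z.1 i).rank := by
      intro i
      have hc : Continuous fun z : X × Matrix (α ⊕ α) (α ⊕ α) ℂ => (1 - z.2) * T z.1 i :=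
        (continuous_const.sub continuous_snd).matrix_mul ((hT i).comp continuous_fst)
      exact ((isOpen_le_rank _).preimage hc).mem_nhds (le_refl (rank _))
    have e2 : ∀ i, ∀ᶠ z : X × Matrix (α ⊕ α) (α ⊕ α) ℂ in 𝓝 (a, P),
        ((T a i)ᵀ * P).rank ≤ ((T z.1 i)ᵀ * z.2).rank := by
      intro i
      have hc : Continuous fun z : X × Matrix (α ⊕ α) (α ⊕ α) ℂ => (T z.1 i)ᵀ * z.2 :=
        (((hT i).comp continuous_fst).matrix_transpose).matrix_mul continuous_snd
      exact ((isOpen_le_rank _).preimage hc).mem_nhds (le_refl (rank _))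
    filter_upwards [Filter.eventually_all.mpr e1, Filter.eventually_all.mpr e2] with z h1 h2
    refine (h P hPP hPb).trans ?_
    refine Finset.sum_le_sum fun i _ => mul_le_mul_of_nonneg_left ?_ (hw i)
    exact_mod_cast add_le_add (h1 i) (h2 i)

theorem Semistable.of_orthonormal [∀ i, DecidableEq (κ i)] {T : ∀ i, Matrix (α ⊕ α) (κ i) ℂ}
    {w : I → ℝ} (hw : ∀ i, 0 ≤ w i) (hT : ∀ i, (T i)ᴴ * T i = 1)
    (hM : ∀ p q : α ⊕ α, p.isLeft = q.isLeft → ((∑ i, (w i : ℂ) • (T i * (T i)ᴴ)) p q).im = 0) :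
    Semistable T w := by
  refine Semistable.of_hermitian hw fun P hH hP hb => ?_
  have hP' : (1 - P) * (1 - P) = 1 - P := by
    simp [Matrix.sub_mul, Matrix.mul_sub, hP]
  have hH' : (1 - P)ᴴ = 1 - P := by rw [conjTranspose_sub, hH, conjTranspose_one]
  have hTt : ∀ i, (T i)ᵀ * (T i)ᴴᵀ = 1 := fun i => by
    rw [← transpose_mul, hT, transpose_one]
  have hc : ∀ i, ((T i)ᴴᵀ)ᴴ = (T i)ᵀ := fun i => by
    ext; simp
  have r1 : ∀ i, (Fintype.card (κ i) : ℝ) - (P * (T i * (T i)ᴴ)).trace.re ≤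
      ((1 - P) * T i).rank := by
    intro i
    have e : ((1 - P) * T i)ᴴ * ((1 - P) * T i) = 1 - (P * T i)ᴴ * (P * T i) := by
      simp only [conjTranspose_mul, hH, hH']
      rw [Matrix.mul_assoc, ← Matrix.mul_assoc (1 - P), hP', Matrix.mul_assoc _ P,
        ← Matrix.mul_assoc P P, hP, Matrix.sub_mul, Matrix.mul_sub, Matrix.one_mul, hT]
    have h := re_trace_le_rank ((1 - P) * T i) (by
      rw [e, sub_sub_cancel]; exact posSemidef_conjTranspose_mul_self _)
    refine le_trans (le_of_eq ?_) h
    rw [e, trace_sub, trace_one, Complex.sub_re, Complex.natCast_re]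
    congr 2
    rw [conjTranspose_mul, hH, Matrix.mul_assoc, ← Matrix.mul_assoc P P, hP,
      Matrix.trace_mul_comm ((T i)ᴴ), Matrix.mul_assoc]
  have r2 : ∀ i, (P * ((T i)ᴴᵀ * (T i)ᵀ)).trace.re ≤ ((T i)ᵀ * P).rank := by
    intro i
    have e0 : (P * (T i)ᴴᵀ)ᴴ = (T i)ᵀ * P := by rw [conjTranspose_mul, hH, hc]
    have e : (P * (T i)ᴴᵀ)ᴴ * (P * (T i)ᴴᵀ) =
        1 - ((1 - P) * (T i)ᴴᵀ)ᴴ * ((1 - P) * (T i)ᴴᵀ) := by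
      simp only [conjTranspose_mul, hH, hH', hc]
      rw [Matrix.mul_assoc _ (1 - P), ← Matrix.mul_assoc (1 - P), hP', Matrix.mul_assoc _ P,
        ← Matrix.mul_assoc P P, hP, Matrix.sub_mul, Matrix.mul_sub, Matrix.one_mul, hTt,
        sub_sub_cancel]
    have h := re_trace_le_rank (P * (T i)ᴴᵀ) (by
      rw [e, sub_sub_cancel]; exact posSemidef_conjTranspose_mul_self _)
    rw [← rank_conjTranspose, e0] at h
    refine le_trans (le_of_eq ?_) h
    rw [Matrix.mul_assoc _ P, ← Matrix.mul_assoc P P, hP, Matrix.trace_mul_comm ((T i)ᵀ),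
      Matrix.mul_assoc P]
  set M := ∑ i, (w i : ℂ) • (T i * (T i)ᴴ) with hMdef
  have hMc : M - (∑ i, (w i : ℂ) • ((T i)ᴴᵀ * (T i)ᵀ)) = M - M.map (starRingEnd ℂ) := by
    congr 1
    ext p q
    simp only [hMdef, map_apply, Matrix.sum_apply, map_sum, Matrix.smul_apply, smul_eq_mul, map_mul,
      Complex.conj_ofReal]
    refine Finset.sum_congr rfl fun i _ => ?_
    congr 1
    simp [Matrix.mul_apply]
  have htr : (P * (M - M.map (starRingEnd ℂ))).trace = 0 := by
    refine Finset.sum_eq_zero fun p _ => ?_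
    rw [diag_apply, Matrix.mul_apply]
    refine Finset.sum_eq_zero fun q _ => ?_
    by_cases hpq : p.isLeft = q.isLeft
    · have : (M - M.map (starRingEnd ℂ)) q p = 0 := by
        rw [Matrix.sub_apply, map_apply, Complex.sub_conj, hM q p hpq.symm]; simp
      rw [this, mul_zero]
    · rw [(isBD_iff P).mp hb p q hpq, zero_mul]
  rw [← hMc, hMdef, ← Finset.sum_sub_distrib, Matrix.mul_sum, trace_sum] at htr
  have htr' := congrArg Complex.re htr
  rw [Complex.re_sum] at htr'
  simp only [← smul_sub, Matrix.mul_smul, trace_smul, smul_eq_mul, Complex.re_ofReal_mul,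
    Matrix.mul_sub, trace_sub, Complex.sub_re, Complex.zero_re] at htr'
  calc ∑ i, w i * (Fintype.card (κ i) : ℝ)
      = ∑ i, w i * ((Fintype.card (κ i) : ℝ) - (P * (T i * (T i)ᴴ)).trace.re +
        (P * ((T i)ᴴᵀ * (T i)ᵀ)).trace.re) := by
        rw [← sub_eq_zero, ← Finset.sum_sub_distrib, ← htr']
        exact Finset.sum_congr rfl fun i _ => by ring
    _ ≤ _ := by
        refine Finset.sum_le_sum fun i _ => mul_le_mul_of_nonneg_left ?_ (hw i)
        push_cast
        exact add_le_add (r1 i) (r2 i)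

end Semistable

section Diagonalize

theorem exists_unitary_diag {α : Type*} [Fintype α] [DecidableEq α] {h : Matrix α α ℂ}
    (hh : h.PosDef) : ∃ (U : Matrix α α ℂ) (x : α → ℝ), Uᴴ * U = 1 ∧
      h = U * diagonal (fun p => (Real.exp (x p) : ℂ)) * Uᴴ := by
  have hH := hh.isHermitian
  refine ⟨hH.eigenvectorUnitary, fun p => Real.log (hH.eigenvalues p),
    Unitary.coe_star_mul_self hH.eigenvectorUnitary, ?_⟩
  conv_lhs => rw [hH.spectral_theorem, Unitary.conjStarAlgAut_apply]
  have : (RCLike.ofReal ∘ hH.eigenvalues : α → ℂ) =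
      fun p => (Real.exp (Real.log (hH.eigenvalues p)) : ℂ) := by
    ext p
    rw [Real.exp_log (hh.eigenvalues_pos p)]; rfl
  rw [this]; rfl

theorem exists_blockUnitary_diag {α : Type*} [Fintype α] [DecidableEq α]
    {h : Matrix (α ⊕ α) (α ⊕ α) ℂ} (hh : h.PosDef) (hb : IsBD h) :
    ∃ (U : Matrix (α ⊕ α) (α ⊕ α) ℂ) (x : α ⊕ α → ℝ), Uᴴ * U = 1 ∧ IsBD U ∧
      h = U * diagonal (fun p => (Real.exp (x p) : ℂ)) * Uᴴ := by
  obtain ⟨U₁, x₁, hU₁, e₁⟩ := exists_unitary_diag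
    (hh.submatrix (Sum.inl_injective (α := α) (β := α)))
  obtain ⟨U₂, x₂, hU₂, e₂⟩ := exists_unitary_diag
    (hh.submatrix (Sum.inr_injective (α := α) (β := α)))
  have hf : h = fromBlocks (h.submatrix Sum.inl Sum.inl) 0 0 (h.submatrix Sum.inr Sum.inr) := by
    rw [isBD_iff] at hb
    ext (p | p) (q | q)
    · rfl
    · exact hb _ _ (by simp)
    · exact hb _ _ (by simp)
    · rfl
  refine ⟨fromBlocks U₁ 0 0 U₂, Sum.elim x₁ x₂, ?_, isBD_fromBlocks _ _, ?_⟩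
  · rw [fromBlocks_conjTranspose, fromBlocks_multiply]
    simp [hU₁, hU₂]
  · have hd : diagonal (fun p => (Real.exp (Sum.elim x₁ x₂ p) : ℂ)) =
        fromBlocks (diagonal fun p => (Real.exp (x₁ p) : ℂ)) 0 0
          (diagonal fun p => (Real.exp (x₂ p) : ℂ)) := by
      rw [fromBlocks_diagonal]
      congr 1
      ext (p | p) <;> rfl
    rw [hd, fromBlocks_conjTranspose, fromBlocks_multiply, fromBlocks_multiply, hf, e₁, e₂]
    simp

end Diagonalize

section Coercive

variable {α I : Type*} [Fintype α] [DecidableEq α] [Fintype I] {κ : I → Type*}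
  [∀ i, Fintype (κ i)] [∀ i, DecidableEq (κ i)]

omit [∀ i, DecidableEq (κ i)] in
theorem Semistable.slope_nonneg {T : ∀ i, Matrix (α ⊕ α) (κ i) ℂ} {w : I → ℝ}
    (hw : ∀ i, 0 ≤ w i) (h : Semistable T w) (U : Matrix (α ⊕ α) (α ⊕ α) ℂ) (hU : Uᴴ * U = 1)
    (hb : IsBD U) (y : α ⊕ α → ℝ) (f f' : ∀ i, κ i → α ⊕ α)
    (hf : ∀ i, ∀ S : Finset (α ⊕ α), (∀ p ∈ S, ∀ q ∉ S, y q < y p) →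
      (diagonal (fun p => if p ∈ S then (1 : ℂ) else 0) * (Uᴴ * T i)).rank ≤
        (Finset.univ.filter fun j => f i j ∈ S).card)
    (hf' : ∀ i, ∀ S : Finset (α ⊕ α), (∀ p ∈ S, ∀ q ∉ S, -y q < -y p) →
      (diagonal (fun p => if p ∈ S then (1 : ℂ) else 0) * (Uᵀ * T i)).rank ≤
        (Finset.univ.filter fun j => f' i j ∈ S).card) :
    0 ≤ ∑ i, w i * (∑ j, y (f i j) - ∑ j, y (f' i j)) := by
  have hU' : U * Uᴴ = 1 := mul_eq_one_comm.mp hU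
  have key := sum_nonneg_of_levelSums_nonneg (σ := (Σ i, κ i) ⊕ (Σ i, κ i))
    (Sum.elim (fun z => w z.1) (fun z => -w z.1))
    (Sum.elim (fun z => y (f z.1 z.2)) (fun z => y (f' z.1 z.2))) ?_ ?_
  · refine key.trans (le_of_eq ?_)
    simp only [Fintype.sum_sum_type, Sum.elim_inl, Sum.elim_inr, Fintype.sum_sigma, mul_sub,
      Finset.mul_sum, Finset.sum_sub_distrib, neg_mul, Finset.sum_neg_distrib]
    ring
  · intro s
    set S : Finset (α ⊕ α) := Finset.univ.filter fun p => s ≤ y p with hS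
    have hmem : ∀ p, p ∈ S ↔ s ≤ y p := fun p => by simp [hS]
    set DS : Matrix (α ⊕ α) (α ⊕ α) ℂ := diagonal (fun p => if p ∈ S then 1 else 0) with hDS
    set DC : Matrix (α ⊕ α) (α ⊕ α) ℂ := diagonal (fun p => if p ∈ Sᶜ then 1 else 0) with hDC
    have hsum : DS + DC = 1 := by
      rw [hDS, hDC, diagonal_add, ← diagonal_one]
      congr 1; ext p
      by_cases hp : p ∈ S <;> simp [hp]
    have hDCDC : DC * DC = DC := by
      rw [hDC, diagonal_mul_diagonal]
      congr 1; ext p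
      by_cases hp : p ∈ S <;> simp [hp]
    have hP := h (U * DC * Uᴴ) (by
      rw [Matrix.mul_assoc (U * DC), ← Matrix.mul_assoc Uᴴ, ← Matrix.mul_assoc Uᴴ, hU,
        Matrix.one_mul, ← Matrix.mul_assoc, Matrix.mul_assoc U DC DC, hDCDC])
      ((hb.mul (IsBD.diagonal _)).mul hb.conjTranspose)
    have h1 : ∀ i, ((1 - U * DC * Uᴴ) * T i).rank ≤
        (Finset.univ.filter fun j => s ≤ y (f i j)).card := by
      intro i
      have e : (1 - U * DC * Uᴴ) * T i = U * (DS * (Uᴴ * T i)) := by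
        have : DS = 1 - DC := by rw [← hsum, add_sub_cancel_right]
        rw [this]
        simp only [Matrix.sub_mul, Matrix.mul_sub, Matrix.one_mul, ← Matrix.mul_assoc, hU']
      rw [e]
      refine (rank_mul_le_right _ _).trans ((hf i S fun p hp q hq => ?_).trans (le_of_eq ?_))
      · rw [hmem] at hp hq
        linarith
      · simp only [hmem]
    have h2 : ∀ i, ((T i)ᵀ * (U * DC * Uᴴ)).rank +
        (Finset.univ.filter fun j => s ≤ y (f' i j)).card ≤ Fintype.card (κ i) := by
      intro i
      have e : (T i)ᵀ * (U * DC * Uᴴ) = (DC * (Uᵀ * T i))ᵀ * Uᴴ := by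
        rw [transpose_mul, transpose_mul, transpose_transpose, hDC, diagonal_transpose]
        simp only [Matrix.mul_assoc]
      have h3 : ((T i)ᵀ * (U * DC * Uᴴ)).rank ≤
          (Finset.univ.filter fun j => ¬ s ≤ y (f' i j)).card := by
        rw [e]
        refine (rank_mul_le_left _ _).trans ?_
        rw [rank_transpose]
        refine (hf' i Sᶜ fun p hp q hq => ?_).trans (le_of_eq ?_)
        · rw [Finset.mem_compl, hmem, not_le] at hp
          rw [Finset.mem_compl, hmem, not_not] at hq
          linarith
        · simp only [Finset.mem_compl, hmem]
      have h4 := Finset.card_filter_add_card_filter_not (s := (Finset.univ : Finset (κ i)))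
        (fun j => s ≤ y (f' i j))
      rw [Finset.card_univ] at h4
      omega
    have e1 : ∀ i, (∑ j, if s ≤ y (f i j) then w i else 0) =
        w i * (Finset.univ.filter fun j => s ≤ y (f i j)).card := fun i => by
      rw [← Finset.sum_filter, Finset.sum_const, nsmul_eq_mul, mul_comm]
    have e2 : ∀ i, (∑ j, if s ≤ y (f' i j) then -w i else 0) =
        -(w i * (Finset.univ.filter fun j => s ≤ y (f' i j)).card) := fun i => by
      rw [← Finset.sum_filter, Finset.sum_const, nsmul_eq_mul]; ring
    rw [Fintype.sum_sum_type, Fintype.sum_sigma, Fintype.sum_sigma]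
    change 0 ≤ (∑ i, ∑ j, if s ≤ y (f i j) then w i else 0) +
      ∑ i, ∑ j, if s ≤ y (f' i j) then -w i else 0
    rw [Finset.sum_congr rfl fun i _ => e1 i, Finset.sum_congr rfl fun i _ => e2 i,
      Finset.sum_neg_distrib, ← sub_eq_add_neg, sub_nonneg]
    have h5 : ∑ i, w i * (((Finset.univ.filter fun j => s ≤ y (f' i j)).card : ℕ) : ℝ) +
        ∑ i, w i * (((1 - U * DC * Uᴴ) * T i).rank + ((T i)ᵀ * (U * DC * Uᴴ)).rank : ℕ) ≤
        ∑ i, w i * (((Finset.univ.filter fun j => s ≤ y (f i j)).card : ℕ) : ℝ) +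
        ∑ i, w i * Fintype.card (κ i) := by
      rw [← Finset.sum_add_distrib, ← Finset.sum_add_distrib]
      refine Finset.sum_le_sum fun i _ => ?_
      rw [← mul_add, ← mul_add]
      refine mul_le_mul_of_nonneg_left ?_ (hw i)
      have := h1 i
      have := h2 i
      norm_cast
      omega
    linarith
  · simp [Fintype.sum_sum_type]

end Coercive

section Coercive

theorem log_det_lower_bound {m κ : Type*} [Fintype m] [DecidableEq m] [Fintype κ] [DecidableEq κ]
    (A : Matrix m κ ℂ) (x : m → ℝ) (f : κ → m) (hf : (A.submatrix f id).det ≠ 0) :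
    ∑ j, x (f j) + Real.log (‖(A.submatrix f id).det‖ ^ 2) -
      Real.log (Fintype.card κ).factorial ≤
    Real.log (Aᴴ * diagonal (fun p => (Real.exp (x p) : ℂ)) * A).det.re := by
  have h := prod_mul_norm_det_sq_le A (fun p => Real.exp (x p)) (fun p => (Real.exp_pos _).le) f
  have hpos : 0 < ‖(A.submatrix f id).det‖ ^ 2 := by positivity
  have hk : (0 : ℝ) < (Fintype.card κ).factorial := by exact_mod_cast Nat.factorial_pos _
  rw [← Real.exp_sum] at h
  have hd : 0 < (Aᴴ * diagonal (fun p => (Real.exp (x p) : ℂ)) * A).det.re := by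
    have := lt_of_lt_of_le (mul_pos (Real.exp_pos (∑ j, x (f j))) hpos) h
    exact pos_of_mul_pos_right this hk.le
  have h2 := Real.log_le_log (mul_pos (Real.exp_pos _) hpos) h
  rw [Real.log_mul (Real.exp_pos _).ne' hpos.ne', Real.log_exp, Real.log_mul hk.ne' hd.ne'] at h2
  linarith

theorem conjTranspose_mul_self_eq_of_orthogonal {m : Type*} [Fintype m] [DecidableEq m]
    {g U : Matrix m m ℂ} {x : m → ℝ} (hg : gᵀ * g = 1) (hU : Uᴴ * U = 1)
    (h : gᴴ * g = U * diagonal (fun p => (Real.exp (x p) : ℂ)) * Uᴴ) :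
    gᴴ * g = Uᴴᵀ * diagonal (fun p => (Real.exp (-x p) : ℂ)) * Uᵀ := by
  have h1 : g * gᵀ = 1 := mul_eq_one_comm.mp hg
  have h2 : gᴴ * gᴴᵀ = 1 := by
    have : gᴴᵀ * gᴴ = (g * gᵀ)ᴴ := by
      rw [conjTranspose_mul]; congr 1
    rw [h1, conjTranspose_one] at this
    exact mul_eq_one_comm.mp this
  have h3 : (gᴴ * g) * (gᴴ * g)ᵀ = 1 := by
    rw [transpose_mul, Matrix.mul_assoc, ← Matrix.mul_assoc g, h1, Matrix.one_mul, h2]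
  have h4 : (gᴴ * g) * (U * diagonal (fun p => (Real.exp (-x p) : ℂ)) * Uᴴ) = 1 := by
    rw [h]
    have e : diagonal (fun p => (Real.exp (x p) : ℂ)) * diagonal (fun p => (Real.exp (-x p) : ℂ))
        = 1 := by
      rw [diagonal_mul_diagonal, ← diagonal_one]
      congr 1; ext p
      rw [← Complex.ofReal_mul, ← Real.exp_add]; simp
    calc _ = U * (diagonal (fun p => (Real.exp (x p) : ℂ)) * (Uᴴ * U) *
        diagonal (fun p => (Real.exp (-x p) : ℂ))) * Uᴴ := by simp only [Matrix.mul_assoc]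
      _ = 1 := by rw [hU, Matrix.mul_one, e, Matrix.mul_one, mul_eq_one_comm.mp hU]
  have h5 : (gᴴ * g)ᵀ = U * diagonal (fun p => (Real.exp (-x p) : ℂ)) * Uᴴ :=
    left_inv_eq_right_inv (mul_eq_one_comm.mp h3) h4
  rw [← transpose_transpose (gᴴ * g), h5, transpose_mul, transpose_mul, diagonal_transpose,
    Matrix.mul_assoc]

variable {α I : Type*} [Fintype α] [DecidableEq α] [Fintype I] {κ : I → Type}
  [∀ i, Fintype (κ i)] [∀ i, DecidableEq (κ i)]

/-- The logarithmic energy of `g` with respect to weighted frames, with a small trace penalty. -/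
noncomputable def logEnergy (T : ∀ i, Matrix (α ⊕ α) (κ i) ℂ) (w : I → ℝ) (ε : ℝ)
    (g : Matrix (α ⊕ α) (α ⊕ α) ℂ) : ℝ :=
  ∑ i, w i * Real.log ((g * T i)ᴴ * (g * T i)).det.re + ε * Real.log (gᴴ * g).trace.re

/-- Block diagonal complex orthogonal matrices. -/
def blockOrthogonal (α : Type*) [Fintype α] [DecidableEq α] :
    Set (Matrix (α ⊕ α) (α ⊕ α) ℂ) := {g | gᵀ * g = 1 ∧ IsBD g}

theorem isUnit_det_of_transpose_mul {m : Type*} [Fintype m] [DecidableEq m]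
    {g : Matrix m m ℂ} (hg : gᵀ * g = 1) : IsUnit g.det :=
  (Matrix.isUnit_iff_isUnit_det g).mp (IsUnit.of_mul_eq_one_right _ hg)

theorem posDef_frame {m κ : Type*} [Fintype m] [DecidableEq m] [Fintype κ]
    {g : Matrix m m ℂ} {T : Matrix m κ ℂ} (hg : IsUnit g.det)
    (hT : Function.Injective T.mulVec) : ((g * T)ᴴ * (g * T)).PosDef := by
  apply PosDef.conjTranspose_mul_self
  have : (g * T).mulVec = g.mulVec ∘ T.mulVec := by ext v; simp [mulVec_mulVec]
  rw [this]
  exact (mulVec_injective_of_isUnit ((isUnit_iff_isUnit_det g).mpr hg)).comp hT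

/-- Polar data of a block orthogonal matrix, and the resulting lower bound for the energy. -/
theorem exists_polar_of_blockOrthogonal {g : Matrix (α ⊕ α) (α ⊕ α) ℂ}
    (hg : g ∈ blockOrthogonal α) :
    ∃ (U : Matrix (α ⊕ α) (α ⊕ α) ℂ) (x : α ⊕ α → ℝ), Uᴴ * U = 1 ∧ IsBD U ∧
      ((gᴴ * g).trace.re ≤ Fintype.card (α ⊕ α) * Real.exp ‖x‖) ∧
      (0 < Fintype.card α → ‖x‖ ≤ Real.log (gᴴ * g).trace.re) ∧
      ∀ {κ : Type} [Fintype κ] [DecidableEq κ] (T : Matrix (α ⊕ α) κ ℂ),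
        ((g * T)ᴴ * (g * T) =
          (Uᴴ * T)ᴴ * diagonal (fun p => (Real.exp (x p) : ℂ)) * (Uᴴ * T)) ∧
        ((g * T)ᴴ * (g * T) =
          (Uᵀ * T)ᴴ * diagonal (fun p => (Real.exp (-x p) : ℂ)) * (Uᵀ * T)) := by
  obtain ⟨hgo, hb⟩ := hg
  have hpd : (gᴴ * g).PosDef := by
    have := posDef_frame (T := (1 : Matrix (α ⊕ α) (α ⊕ α) ℂ)) (isUnit_det_of_transpose_mul hgo)
      (fun u v h => by simpa using h)
    simpa using this
  obtain ⟨U, x, hU, hUb, h⟩ := exists_blockUnitary_diag hpd (hb.conjTranspose.mul hb)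
  have h' := conjTranspose_mul_self_eq_of_orthogonal hgo hU h
  have t1 : (gᴴ * g).trace.re = ∑ p, Real.exp (x p) := by
    rw [h, Matrix.trace_mul_comm, ← Matrix.mul_assoc, hU, Matrix.one_mul, trace_diagonal,
      ← Complex.ofReal_sum, Complex.ofReal_re]
  have t2 : (gᴴ * g).trace.re = ∑ p, Real.exp (-x p) := by
    rw [h', Matrix.trace_mul_comm, ← Matrix.mul_assoc, ← transpose_mul, hU, transpose_one,
      Matrix.one_mul, trace_diagonal, ← Complex.ofReal_sum, Complex.ofReal_re]
  have hpos : 0 < Fintype.card α → 0 < (gᴴ * g).trace.re := fun h => by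
    have : Nonempty α := Fintype.card_pos_iff.mp h
    rw [t1]
    exact Finset.sum_pos (fun p _ => Real.exp_pos _) Finset.univ_nonempty
  refine ⟨U, x, hU, hUb, ?_, fun hc => ?_, fun T => ⟨?_, ?_⟩⟩
  · rw [t1, ← nsmul_eq_mul, ← Finset.card_univ]
    exact Finset.sum_le_card_nsmul _ _ _ fun p _ =>
      Real.exp_le_exp.mpr ((le_abs_self _).trans (norm_le_pi_norm x p))
  · have hp := hpos hc
    have : Nonempty α := Fintype.card_pos_iff.mp hc
    refine (pi_norm_le_iff_of_nonempty x).mpr fun p => ?_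
    rw [Real.norm_eq_abs, abs_le']
    constructor
    · rw [Real.le_log_iff_exp_le hp, t1]
      exact Finset.single_le_sum (f := fun p => Real.exp (x p)) (fun _ _ => (Real.exp_pos _).le)
        (Finset.mem_univ p)
    · rw [Real.le_log_iff_exp_le hp, t2]
      exact Finset.single_le_sum (f := fun p => Real.exp (-x p)) (fun _ _ => (Real.exp_pos _).le)
        (Finset.mem_univ p)
  · rw [conjTranspose_mul, Matrix.mul_assoc, ← Matrix.mul_assoc gᴴ, h]
    simp only [conjTranspose_mul, conjTranspose_conjTranspose, Matrix.mul_assoc]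
  · rw [conjTranspose_mul, Matrix.mul_assoc, ← Matrix.mul_assoc gᴴ, h']
    have : Uᵀᴴ = Uᴴᵀ := rfl
    simp only [conjTranspose_mul, this, Matrix.mul_assoc]

theorem Semistable.logEnergy_coercive [Nonempty α] {T : ∀ i, Matrix (α ⊕ α) (κ i) ℂ} {w : I → ℝ}
    (hw : ∀ i, 0 ≤ w i) (h : Semistable T w) (hT : ∀ i, Function.Injective (T i).mulVec)
    {ε : ℝ} (hε : 0 < ε) (C : ℝ) :
    ∃ K : ℝ, ∀ g ∈ blockOrthogonal α, logEnergy T w ε g ≤ C → (gᴴ * g).trace.re ≤ K := by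
  by_contra! hcon
  choose g hg hgC hgN using fun k : ℕ => hcon k
  choose U x hU hUb hx1 hx2 hx3 using fun k => exists_polar_of_blockOrthogonal (hg k)
  set N : ℝ := ((Fintype.card (α ⊕ α) : ℕ) : ℝ) with hN
  have hNpos : 0 < N := by rw [hN]; exact_mod_cast Fintype.card_pos
  have hR : Filter.Tendsto (fun k => ‖x k‖) Filter.atTop Filter.atTop := by
    have h1 : Filter.Tendsto (fun k : ℕ => Real.log (k / N)) Filter.atTop Filter.atTop :=
      Real.tendsto_log_atTop.comp (tendsto_natCast_atTop_atTop.atTop_div_const hNpos)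
    refine Filter.tendsto_atTop_mono (fun k => ?_) h1
    rcases Nat.eq_zero_or_pos k with rfl | hk
    · simp
    · have hk' : (0 : ℝ) < k := by exact_mod_cast hk
      rw [Real.log_le_iff_le_exp (by positivity), div_le_iff₀ hNpos, mul_comm]
      exact (hgN k).le.trans (hx1 k)
  have hcompU : IsCompact {A : Matrix (α ⊕ α) (α ⊕ α) ℂ | ∀ i j, ‖A i j‖ ≤ 1} :=
    isCompact_setOf_norm_apply_le 1
  have hcomp := hcompU.prod (isCompact_closedBall (0 : α ⊕ α → ℝ) 1)
  have : FirstCountableTopology (Matrix (α ⊕ α) (α ⊕ α) ℂ) :=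
    inferInstanceAs (FirstCountableTopology (α ⊕ α → α ⊕ α → ℂ))
  obtain ⟨⟨V, y⟩, -, φ, hφ, hlim⟩ := hcomp.tendsto_subseq
    (x := fun k => (U k, ‖x k‖⁻¹ • x k)) (fun k => ⟨fun i j =>
      norm_apply_le_one_of_diag (U k) (fun j => by rw [hU]; simp) i j, by
        rw [mem_closedBall_zero_iff, norm_smul, norm_inv, norm_norm]
        exact inv_mul_le_one⟩)
  have hlimU : Filter.Tendsto (fun k => U (φ k)) Filter.atTop (𝓝 V) :=
    (continuous_fst.tendsto _).comp hlim
  have hlimy : Filter.Tendsto (fun k => ‖x (φ k)‖⁻¹ • x (φ k)) Filter.atTop (𝓝 y) :=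
    (continuous_snd.tendsto _).comp hlim
  have hV : Vᴴ * V = 1 := by
    have hc : IsClosed {A : Matrix (α ⊕ α) (α ⊕ α) ℂ | Aᴴ * A = 1} :=
      isClosed_eq (by fun_prop) continuous_const
    exact hc.mem_of_tendsto hlimU (Filter.Eventually.of_forall fun k => hU _)
  have hVb : IsBD V := by
    have hc : IsClosed {A : Matrix (α ⊕ α) (α ⊕ α) ℂ | IsBD A} :=
      isClosed_eq (by fun_prop) (by fun_prop)
    exact hc.mem_of_tendsto hlimU (Filter.Eventually.of_forall fun k => hUb _)
  have hVu : IsUnit Vᴴ.det := by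
    rw [← isUnit_iff_isUnit_det]; exact IsUnit.of_mul_eq_one _ hV
  have hVu' : IsUnit Vᵀ.det := by
    rw [det_transpose, ← isUnit_iff_isUnit_det]
    exact IsUnit.of_mul_eq_one_right _ hV
  choose f hf0 hf using fun i =>
    exists_greedy_rows (Vᴴ * T i) (posDef_frame hVu (hT i)).det_pos.ne' y
  choose f' hf0' hf' using fun i =>
    exists_greedy_rows (Vᵀ * T i) (posDef_frame hVu' (hT i)).det_pos.ne' (-y)
  have hslope := h.slope_nonneg hw V hV hVb y f f' hf hf'
  set δ : Matrix (α ⊕ α) (α ⊕ α) ℂ → ∀ i, ℂ := fun A i => ((Aᴴ * T i).submatrix (f i) id).det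
  set δ' : Matrix (α ⊕ α) (α ⊕ α) ℂ → ∀ i, ℂ := fun A i => ((Aᵀ * T i).submatrix (f' i) id).det
  have hδc : ∀ i, Continuous fun A => δ A i := fun i => by
    refine Continuous.matrix_det ?_
    exact Continuous.matrix_submatrix (by fun_prop) _ _
  have hδc' : ∀ i, Continuous fun A => δ' A i := fun i => by
    refine Continuous.matrix_det ?_
    exact Continuous.matrix_submatrix (by fun_prop) _ _
  set c : ∀ i, ℝ := fun i => 2 * Real.log (Fintype.card (κ i)).factorial
  set F : Matrix (α ⊕ α) (α ⊕ α) ℂ → ℝ := fun A =>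
    ∑ i, w i * (Real.log (‖δ A i‖ ^ 2) + Real.log (‖δ' A i‖ ^ 2) - c i) with hF
  have hFlim : Filter.Tendsto (fun k => F (U (φ k))) Filter.atTop (𝓝 (F V)) := by
    suffices hs : Filter.Tendsto F (𝓝 V) (𝓝 (F V)) from hs.comp hlimU
    refine tendsto_finsetSum _ fun i _ => ?_
    refine Filter.Tendsto.const_mul _ (Filter.Tendsto.sub_const (Filter.Tendsto.add ?_ ?_) _)
    · refine Filter.Tendsto.log (((hδc i).norm.pow 2).tendsto V) ?_
      exact pow_ne_zero _ (norm_ne_zero_iff.mpr (hf0 i))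
    · refine Filter.Tendsto.log (((hδc' i).norm.pow 2).tendsto V) ?_
      exact pow_ne_zero _ (norm_ne_zero_iff.mpr (hf0' i))
  have hev : ∀ᶠ k in Filter.atTop, ∀ i, δ (U (φ k)) i ≠ 0 ∧ δ' (U (φ k)) i ≠ 0 := by
    refine Filter.eventually_all.mpr fun i => ?_
    exact (((hδc i).tendsto V).comp hlimU |>.eventually_ne (hf0 i)).and
      (((hδc' i).tendsto V).comp hlimU |>.eventually_ne (hf0' i))
  have hRφ : Filter.Tendsto (fun k => ‖x (φ k)‖) Filter.atTop Filter.atTop :=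
    hR.comp hφ.tendsto_atTop
  have hbound : ∀ᶠ k in Filter.atTop,
      (∑ i, w i * (∑ j, (‖x (φ k)‖⁻¹ • x (φ k)) (f i j) - ∑ j, (‖x (φ k)‖⁻¹ • x (φ k)) (f' i j))) +
        ‖x (φ k)‖⁻¹ * F (U (φ k)) + 2 * ε ≤ ‖x (φ k)‖⁻¹ * (2 * C) := by
    filter_upwards [hev, hRφ.eventually_gt_atTop 0] with k hk hk0
    set R := ‖x (φ k)‖ with hRdef
    have hb : (∑ i, w i * (∑ j, x (φ k) (f i j) - ∑ j, x (φ k) (f' i j))) + F (U (φ k)) +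
        2 * ε * R ≤ 2 * C := by
      have h1 := hgC (φ k)
      have h2 := hx2 (φ k) Fintype.card_pos
      unfold logEnergy at h1
      have h3 : ∀ i, (∑ j, x (φ k) (f i j) - ∑ j, x (φ k) (f' i j)) +
          (Real.log (‖δ (U (φ k)) i‖ ^ 2) + Real.log (‖δ' (U (φ k)) i‖ ^ 2) - c i) ≤
          2 * Real.log ((g (φ k) * T i)ᴴ * (g (φ k) * T i)).det.re := by
        intro i
        have l1 := log_det_lower_bound _ (x (φ k)) (f i) (hk i).1
        have l2 := log_det_lower_bound _ (fun p => -x (φ k) p) (f' i) (hk i).2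
        rw [← (hx3 (φ k) (T i)).1] at l1
        rw [← (hx3 (φ k) (T i)).2, Finset.sum_neg_distrib] at l2
        simp only [c, δ, δ']
        linarith
      have h4 := Finset.sum_le_sum fun i (_ : i ∈ Finset.univ) =>
        mul_le_mul_of_nonneg_left (h3 i) (hw i)
      simp only [mul_add, Finset.sum_add_distrib] at h4
      have h5 : ∑ i, w i * (2 * Real.log ((g (φ k) * T i)ᴴ * (g (φ k) * T i)).det.re) =
          2 * ∑ i, w i * Real.log ((g (φ k) * T i)ᴴ * (g (φ k) * T i)).det.re := by
        rw [Finset.mul_sum]; exact Finset.sum_congr rfl fun i _ => by ring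
      rw [h5] at h4
      have h6 := mul_le_mul_of_nonneg_left h2 hε.le
      simp only [hF]
      simp only [mul_add, mul_sub, Finset.sum_add_distrib, Finset.sum_sub_distrib] at h4 ⊢
      linarith
    have e : (∑ i, w i * (∑ j, (R⁻¹ • x (φ k)) (f i j) - ∑ j, (R⁻¹ • x (φ k)) (f' i j))) =
        R⁻¹ * ∑ i, w i * (∑ j, x (φ k) (f i j) - ∑ j, x (φ k) (f' i j)) := by
      simp only [Pi.smul_apply, smul_eq_mul, ← Finset.mul_sum, ← mul_sub]
      rw [Finset.mul_sum]
      exact Finset.sum_congr rfl fun i _ => by ring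
    rw [e]
    have h7 := mul_le_mul_of_nonneg_left hb (inv_pos.mpr hk0).le
    have h8 : R⁻¹ * (2 * ε * R) = 2 * ε := by field_simp
    rw [mul_add, mul_add, h8] at h7
    exact h7
  have hinv : Filter.Tendsto (fun k => ‖x (φ k)‖⁻¹) Filter.atTop (𝓝 0) :=
    tendsto_inv_atTop_zero.comp hRφ
  have hycoord : ∀ p, Filter.Tendsto (fun k => (‖x (φ k)‖⁻¹ • x (φ k)) p) Filter.atTop (𝓝 (y p)) :=
    fun p => ((continuous_apply p).tendsto y).comp hlimy
  have hL : Filter.Tendsto (fun k =>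
      (∑ i, w i * (∑ j, (‖x (φ k)‖⁻¹ • x (φ k)) (f i j) - ∑ j, (‖x (φ k)‖⁻¹ • x (φ k)) (f' i j))) +
        ‖x (φ k)‖⁻¹ * F (U (φ k)) + 2 * ε) Filter.atTop
      (𝓝 ((∑ i, w i * (∑ j, y (f i j) - ∑ j, y (f' i j))) + 0 * F V + 2 * ε)) := by
    refine Filter.Tendsto.add_const _ (Filter.Tendsto.add ?_ (hinv.mul hFlim))
    refine tendsto_finsetSum _ fun i _ => Filter.Tendsto.const_mul _ (Filter.Tendsto.sub ?_ ?_)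
    · exact tendsto_finsetSum _ fun j _ => hycoord _
    · exact tendsto_finsetSum _ fun j _ => hycoord _
  have := le_of_tendsto_of_tendsto hL (hinv.mul_const (2 * C)) hbound
  linarith

end Coercive

section Critical

theorem log_det_le_trace_sub_card {κ : Type*} [Fintype κ] [DecidableEq κ] {C : Matrix κ κ ℂ}
    (hC : C.PosDef) : Real.log C.det.re ≤ C.trace.re - Fintype.card κ := by
  have h1 : C.det.re = ∏ i, hC.1.eigenvalues i := by
    rw [hC.1.det_eq_prod_eigenvalues]; norm_cast
  have h2 : C.trace.re = ∑ i, hC.1.eigenvalues i := by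
    rw [hC.1.trace_eq_sum_eigenvalues]; simp
  rw [h1, h2, Real.log_prod (fun i _ => (hC.eigenvalues_pos i).ne')]
  calc ∑ i, Real.log (hC.1.eigenvalues i) ≤ ∑ i, (hC.1.eigenvalues i - 1) :=
        Finset.sum_le_sum fun i _ => Real.log_le_sub_one_of_pos (hC.eigenvalues_pos i)
    _ = _ := by simp

variable {m : Type*} [Fintype m] [DecidableEq m]

theorem exists_boost {p q : m} (hpq : p ≠ q) (b : ℝ) :
    ∃ (E : Matrix m m ℂ) (a c : ℝ), 1 ≤ c ∧
      E = 1 + (a : ℂ) • (single p p 1 + single q q 1) +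
        (b : ℂ) • (single p q Complex.I - single q p Complex.I) ∧ Eᵀ * E = 1 ∧
      Eᴴ * E = 1 + ((2 * b ^ 2 : ℝ) : ℂ) • (single p p 1 + single q q 1) +
        ((2 * b * c : ℝ) : ℂ) • (single p q Complex.I - single q p Complex.I) := by
  set D : Matrix m m ℂ := single p p 1 + single q q 1 with hD
  set J : Matrix m m ℂ := single p q Complex.I - single q p Complex.I with hJ
  have hneg : ∀ (i j : m) (x : ℂ), single i j (-x) = -single i j x := fun i j x =>
    (single_neg i j x).symm
  have hDD : D * D = D := by
    simp [hD, mul_add, add_mul, single_mul_single_of_ne, hpq, hpq.symm]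
  have hDJ : D * J = J := by
    simp [hD, hJ, mul_sub, add_mul, single_mul_single_of_ne, hpq, hpq.symm]
  have hJD : J * D = J := by
    simp [hD, hJ, sub_mul, mul_add, single_mul_single_of_ne, hpq, hpq.symm]
    abel
  have hJJ : J * J = D := by
    simp [hD, hJ, sub_mul, mul_sub, single_mul_single_of_ne, hpq, hpq.symm, hneg]
    abel
  have hDt : Dᵀ = D := by simp [hD]
  have hJt : Jᵀ = -J := by simp [hJ]
  have hDc : Dᴴ = D := by simp [hD]
  have hJc : Jᴴ = J := by simp [hJ, conjTranspose_single, hneg]; abel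
  set c := √(1 + b ^ 2) with hc
  have hcc : c ^ 2 = 1 + b ^ 2 := Real.sq_sqrt (by positivity)
  have hmul : ∀ a b a' b' : ℂ, (1 + a • D + b • J) * (1 + a' • D + b' • J) =
      1 + (a + a' + a * a' + b * b') • D + (b + b' + a * b' + b * a') • J := by
    intro a b a' b'
    simp only [add_mul, mul_add, one_mul, mul_one, smul_mul_smul_comm, hDD, hDJ, hJD, hJJ, add_smul]
    abel
  have hccC : (c : ℂ) ^ 2 = 1 + (b : ℂ) ^ 2 := by exact_mod_cast hcc
  refine ⟨_, c - 1, c, ?_, rfl, ?_, ?_⟩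
  · rw [hc, Real.one_le_sqrt]; nlinarith [sq_nonneg b]
  · rw [transpose_add, transpose_add, transpose_smul, transpose_smul, hDt, hJt, transpose_one,
      smul_neg, ← neg_smul, hmul]
    push_cast
    have e1 : (c - 1 + (c - 1) + (c - 1) * (c - 1) + -(b : ℂ) * b : ℂ) = 0 := by
      linear_combination hccC
    have e2 : (-b + b + (c - 1) * b + -b * (c - 1) : ℂ) = 0 := by ring
    rw [e1, e2]; simp
  · rw [conjTranspose_add, conjTranspose_add, conjTranspose_smul, conjTranspose_smul, hDc, hJc,
      conjTranspose_one, Complex.star_def, Complex.conj_ofReal, Complex.conj_ofReal, hmul]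
    push_cast
    congr 2
    · congr 1; linear_combination hccC
    · ring

theorem re_trace_boost {κ : Type*} [Fintype κ] (p q : m) (u v : ℝ) (X : Matrix m κ ℂ) :
    (Xᴴ * (1 + (u : ℂ) • (single p p 1 + single q q 1) +
        (v : ℂ) • (single p q Complex.I - single q p Complex.I)) * X).trace.re =
      (Xᴴ * X).trace.re + u * (((X * Xᴴ) p p).re + ((X * Xᴴ) q q).re) +
        v * (2 * ((X * Xᴴ) p q).im) := by
  have h : (X * Xᴴ) q p = star ((X * Xᴴ) p q) := by
    rw [← conjTranspose_apply, conjTranspose_mul, conjTranspose_conjTranspose]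
  rw [Matrix.mul_assoc, Matrix.trace_mul_comm, Matrix.mul_assoc]
  simp only [Matrix.add_mul, Matrix.sub_mul, Matrix.smul_mul, Matrix.one_mul, trace_add, trace_sub,
    trace_smul, trace_single_mul]
  rw [h, Matrix.trace_mul_comm Xᴴ X]
  simp
  left; ring

variable {α I : Type*} [Fintype α] [DecidableEq α] [Fintype I] {κ : I → Type}
  [∀ i, Fintype (κ i)] [∀ i, DecidableEq (κ i)]

theorem trace_re_pos_of_isUnit {m : Type*} [Fintype m] [DecidableEq m] [Nonempty m]
    {g : Matrix m m ℂ} (hg : IsUnit g.det) : 0 < (gᴴ * g).trace.re := by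
  have := posDef_frame (T := (1 : Matrix m m ℂ)) hg (fun u v h => by simpa using h)
  rw [Matrix.mul_one] at this
  exact (Complex.pos_iff.mp this.trace_pos).1

omit [DecidableEq m] in
theorem trace_conjTranspose_mul_self_re {κ : Type*} [Fintype κ] (g : Matrix m κ ℂ) :
    (gᴴ * g).trace.re = ∑ j, ∑ i, ‖g i j‖ ^ 2 := by
  simp only [trace, diag_apply, Matrix.mul_apply, conjTranspose_apply, Complex.re_sum,
    Complex.star_def, ← Complex.normSq_eq_conj_mul_self, Complex.ofReal_re,
    Complex.normSq_eq_norm_sq]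

theorem Semistable.exists_minimizer [Nonempty α] {T : ∀ i, Matrix (α ⊕ α) (κ i) ℂ} {w : I → ℝ}
    (hw : ∀ i, 0 ≤ w i) (h : Semistable T w) (hT : ∀ i, Function.Injective (T i).mulVec)
    {ε : ℝ} (hε : 0 < ε) :
    ∃ g ∈ blockOrthogonal α, ∀ g' ∈ blockOrthogonal α,
      logEnergy T w ε g ≤ logEnergy T w ε g' := by
  obtain ⟨K, hK⟩ := h.logEnergy_coercive hw hT hε (logEnergy T w ε 1)
  have h1 : (1 : Matrix (α ⊕ α) (α ⊕ α) ℂ) ∈ blockOrthogonal α := ⟨by simp, IsBD.one⟩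
  set S : Set (Matrix (α ⊕ α) (α ⊕ α) ℂ) := {g | g ∈ blockOrthogonal α ∧ (gᴴ * g).trace.re ≤ K}
  have hS : IsCompact S := by
    refine (isCompact_setOf_norm_apply_le (m := α ⊕ α) (κ := α ⊕ α) (𝕜 := ℂ) √K).of_isClosed_subset
      ?_ ?_
    · refine (((isClosed_eq (by fun_prop) continuous_const).inter
        (isClosed_eq (by fun_prop) (by fun_prop)))).inter
        (isClosed_le (f := fun g : Matrix (α ⊕ α) (α ⊕ α) ℂ => (gᴴ * g).trace.re) ?_
          continuous_const)
      exact Complex.continuous_re.comp (by fun_prop)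
    · rintro g ⟨-, hg⟩ i j
      rw [trace_conjTranspose_mul_self_re] at hg
      refine Real.le_sqrt_of_sq_le (le_trans ?_ hg)
      refine le_trans (Finset.single_le_sum (f := fun i => ‖g i j‖ ^ 2) (fun _ _ => by positivity)
        (Finset.mem_univ i)) ?_
      exact Finset.single_le_sum (f := fun j => ∑ i, ‖g i j‖ ^ 2)
        (fun _ _ => Finset.sum_nonneg fun _ _ => by positivity) (Finset.mem_univ j)
  have hcont : ContinuousOn (logEnergy T w ε) S := by
    refine ContinuousOn.add (continuousOn_finsetSum _ fun i _ => continuousOn_const.mul ?_)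
      (continuousOn_const.mul ?_)
    · refine ContinuousOn.log (Continuous.continuousOn (Complex.continuous_re.comp
        (Continuous.matrix_det (by fun_prop)))) fun g hg => ?_
      exact (Complex.pos_iff.mp
        (posDef_frame (isUnit_det_of_transpose_mul hg.1.1) (hT i)).det_pos).1.ne'
    · refine ContinuousOn.log (Continuous.continuousOn (Complex.continuous_re.comp
        (by fun_prop))) fun g hg => ?_
      exact (trace_re_pos_of_isUnit (isUnit_det_of_transpose_mul hg.1.1)).ne'
  obtain ⟨g, hg, hmin⟩ := hS.exists_isMinOn ⟨1, h1, hK 1 h1 le_rfl⟩ hcont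
  refine ⟨g, hg.1, fun g' hg' => ?_⟩
  rcases le_or_gt (logEnergy T w ε g') (logEnergy T w ε 1) with hle | hlt
  · exact hmin ⟨hg', hK g' hg' hle⟩
  · exact (hmin (⟨h1, hK 1 h1 le_rfl⟩ : (1 : Matrix (α ⊕ α) (α ⊕ α) ℂ) ∈ S)).trans hlt.le

omit [DecidableEq m] in
theorem two_mul_im_mul_conjTranspose_le [Nonempty m] {κ : Type*} [Fintype κ] (X : Matrix m κ ℂ)
    {p q : m} (hpq : p ≠ q) :
    ((X * Xᴴ) p p).re + ((X * Xᴴ) q q).re ≤ (Xᴴ * X).trace.re ∧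
      |2 * ((X * Xᴴ) p q).im| ≤ (Xᴴ * X).trace.re := by
  have hd : ∀ p, ((X * Xᴴ) p p).re = ∑ k, ‖X p k‖ ^ 2 := fun p => by
    simp only [Matrix.mul_apply, conjTranspose_apply, Complex.re_sum, Complex.star_def,
      Complex.mul_conj, Complex.ofReal_re, Complex.normSq_eq_norm_sq]
  have h1 : ((X * Xᴴ) p p).re + ((X * Xᴴ) q q).re ≤ (Xᴴ * X).trace.re := by
    rw [trace_conjTranspose_mul_self_re, Finset.sum_comm, hd, hd]
    exact Finset.add_le_sum (f := fun i => ∑ k, ‖X i k‖ ^ 2) (fun _ _ => by positivity)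
      (Finset.mem_univ p) (Finset.mem_univ q) hpq
  refine ⟨h1, le_trans ?_ h1⟩
  rw [hd, hd, ← Finset.sum_add_distrib, Matrix.mul_apply, Complex.im_sum, Finset.mul_sum]
  refine (Finset.abs_sum_le_sum_abs _ _).trans (Finset.sum_le_sum fun k _ => ?_)
  rw [abs_mul, abs_two]
  have : |(X p k * Xᴴ k q).im| ≤ ‖X p k‖ * ‖X q k‖ := by
    refine (Complex.abs_im_le_norm _).trans ?_
    rw [norm_mul, conjTranspose_apply, norm_star]
  nlinarith [sq_nonneg (‖X p k‖ - ‖X q k‖)]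

theorem log_det_sub_le {κ : Type*} [Fintype κ] [DecidableEq κ] {E g : Matrix m m ℂ}
    {T Y : Matrix m κ ℂ} {R : Matrix κ κ ℂ} (hE : IsUnit E.det) (hT : g * T * R = Y)
    (hY : Yᴴ * Y = 1) :
    Real.log ((E * g * T)ᴴ * (E * g * T)).det.re - Real.log ((g * T)ᴴ * (g * T)).det.re ≤
      (Yᴴ * (Eᴴ * E) * Y).trace.re - Fintype.card κ := by
  have hYi : Function.Injective Y.mulVec := Function.LeftInverse.injective (g := Yᴴ.mulVec)
    fun v => by rw [mulVec_mulVec, hY, one_mulVec]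
  have hpd : (Yᴴ * (Eᴴ * E) * Y).PosDef := by
    have := posDef_frame hE hYi
    rwa [conjTranspose_mul, Matrix.mul_assoc, ← Matrix.mul_assoc Eᴴ, ← Matrix.mul_assoc] at this
  have e : ∀ B : Matrix m m ℂ, (Yᴴ * (Bᴴ * B) * Y).det.re =
      ‖R.det‖ ^ 2 * ((B * g * T)ᴴ * (B * g * T)).det.re := fun B => by
    have : Yᴴ * (Bᴴ * B) * Y = Rᴴ * (((B * g * T)ᴴ * (B * g * T)) * R) := by
      rw [← hT]; simp only [conjTranspose_mul, Matrix.mul_assoc]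
    rw [this, det_mul, det_mul, det_conjTranspose, mul_comm _ R.det, ← mul_assoc,
      Complex.star_def, ← Complex.normSq_eq_conj_mul_self, Complex.re_ofReal_mul,
      Complex.normSq_eq_norm_sq]
  have e1 := e 1
  simp only [conjTranspose_one, Matrix.one_mul, Matrix.mul_one, hY, det_one, Complex.one_re] at e1
  have hR : 0 < ‖R.det‖ ^ 2 := by
    rcases (sq_nonneg ‖R.det‖).eq_or_lt with h | h
    · rw [← h, zero_mul] at e1; exact absurd e1 one_ne_zero
    · exact h
  have hpos := (Complex.pos_iff.mp hpd.det_pos).1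
  have hpos2 := hpos
  rw [e E] at hpos2
  have h2 := log_det_le_trace_sub_card hpd
  rw [e E, Real.log_mul hR.ne' (pos_of_mul_pos_right hpos2 hR.le).ne'] at h2
  have h3 := congrArg Real.log e1
  rw [Real.log_one, Real.log_mul hR.ne' (fun h => by rw [h, mul_zero] at e1; simp at e1)] at h3
  linarith

theorem nonpos_of_forall_le_mul {x c : ℝ} (h : ∀ δ > 0, x ≤ δ * c) : x ≤ 0 := by
  by_contra! hx
  have hc : 0 < c := by have := h 1 one_pos; linarith
  have := h (x / (2 * c)) (by positivity)
  have e : x / (2 * c) * c = x / 2 := by field_simp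
  linarith

/-- The Kempf–Ness argument: a semistable weighted configuration can be moved by a block diagonal
complex orthogonal matrix to one whose moment map is arbitrarily small. -/
theorem Semistable.exists_almost_critical [Nonempty α] {T : ∀ i, Matrix (α ⊕ α) (κ i) ℂ}
    {w : I → ℝ} (hw : ∀ i, 0 ≤ w i) (h : Semistable T w)
    (hT : ∀ i, Function.Injective (T i).mulVec) {ε : ℝ} (hε : 0 < ε) :
    ∃ g ∈ blockOrthogonal α, ∀ (Y : ∀ i, Matrix (α ⊕ α) (κ i) ℂ) (R : ∀ i, Matrix (κ i) (κ i) ℂ),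
      (∀ i, g * T i * R i = Y i) → (∀ i, (Y i)ᴴ * Y i = 1) →
      ∀ p q : α ⊕ α, p.isLeft = q.isLeft →
        |((∑ i, (w i : ℂ) • (Y i * (Y i)ᴴ)) p q).im| ≤ ε := by
  obtain ⟨g, hg, hmin⟩ := h.exists_minimizer hw hT hε
  refine ⟨g, hg, fun Y R hYR hY => ?_⟩
  set M := ∑ i, (w i : ℂ) • (Y i * (Y i)ᴴ) with hM
  have hMH : ∀ p q, M q p = star (M p q) := fun p q => by
    rw [← conjTranspose_apply, hM, conjTranspose_sum]
    simp [conjTranspose_smul, conjTranspose_mul]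
  have key : ∀ p q : α ⊕ α, p ≠ q → p.isLeft = q.isLeft → ∀ b : ℝ,
      ∃ c : ℝ, 1 ≤ c ∧ 0 ≤ 2 * b ^ 2 * ((M p p).re + (M q q).re + ε) +
        2 * b * c * (2 * (M p q).im) + ε * (2 * |b| * c) := by
    intro p q hpq hl b
    obtain ⟨E, a, c, hc, hE, hEE, hEH⟩ := exists_boost hpq b
    refine ⟨c, hc, ?_⟩
    have hEb : IsBD E := by
      rw [isBD_iff]
      intro r s hrs
      have hne : r ≠ s := fun h => hrs (by rw [h])
      have h1 : ¬(p = r ∧ q = s) := by rintro ⟨rfl, rfl⟩; exact hrs hl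
      have h2 : ¬(q = r ∧ p = s) := by rintro ⟨rfl, rfl⟩; exact hrs hl.symm
      have h3 : ∀ t, ¬(t = r ∧ t = s) := by rintro t ⟨rfl, h⟩; exact hne h
      rw [hE]
      simp [hne, h1, h2, h3]
    have hEu := isUnit_det_of_transpose_mul hEE
    have hgu := isUnit_det_of_transpose_mul hg.1
    have hEg : E * g ∈ blockOrthogonal α := by
      refine ⟨?_, hEb.mul hg.2⟩
      rw [transpose_mul, Matrix.mul_assoc, ← Matrix.mul_assoc Eᵀ, hEE, Matrix.one_mul, hg.1]
    have h0 := hmin _ hEg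
    unfold logEnergy at h0
    have h1 : ∀ i, Real.log ((E * g * T i)ᴴ * (E * g * T i)).det.re -
        Real.log ((g * T i)ᴴ * (g * T i)).det.re ≤
        2 * b ^ 2 * (((Y i * (Y i)ᴴ) p p).re + ((Y i * (Y i)ᴴ) q q).re) +
          2 * b * c * (2 * ((Y i * (Y i)ᴴ) p q).im) := fun i => by
      refine (log_det_sub_le hEu (hYR i) (hY i)).trans (le_of_eq ?_)
      rw [hEH, re_trace_boost, hY i, trace_one, Complex.natCast_re]
      ring
    have h2 : Real.log ((E * g)ᴴ * (E * g)).trace.re - Real.log (gᴴ * g).trace.re ≤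
        2 * b ^ 2 + 2 * |b| * c := by
      have hN := trace_re_pos_of_isUnit hgu
      have hN' := trace_re_pos_of_isUnit (isUnit_det_of_transpose_mul hEg.1)
      obtain ⟨b1, b2⟩ := two_mul_im_mul_conjTranspose_le g hpq
      have e1 : ((E * g)ᴴ * (E * g)).trace.re ≤
          (gᴴ * g).trace.re * (1 + 2 * b ^ 2 + 2 * |b| * c) := by
        rw [conjTranspose_mul, Matrix.mul_assoc, ← Matrix.mul_assoc Eᴴ, hEH, ← Matrix.mul_assoc,
          re_trace_boost]
        have e2 := mul_le_mul_of_nonneg_left b1 (by positivity : 0 ≤ 2 * b ^ 2)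
        have e3 : 2 * b * c * (2 * ((g * gᴴ) p q).im) ≤ 2 * |b| * c * (gᴴ * g).trace.re := by
          refine (le_abs_self _).trans ?_
          rw [abs_mul, abs_mul, abs_mul, abs_two, abs_of_nonneg (zero_le_one.trans hc)]
          exact mul_le_mul_of_nonneg_left b2 (by positivity)
        linarith
      rw [← Real.log_div hN'.ne' hN.ne']
      refine (Real.log_le_sub_one_of_pos (by positivity)).trans ?_
      rw [sub_le_iff_le_add, div_le_iff₀ hN]
      linarith
    have h3 := Finset.sum_le_sum fun i (_ : i ∈ Finset.univ) =>
      mul_le_mul_of_nonneg_left (h1 i) (hw i)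
    have h4 := mul_le_mul_of_nonneg_left h2 hε.le
    have hre : ∀ r s, (M r s).re = ∑ i, w i * ((Y i * (Y i)ᴴ) r s).re := fun r s => by
      simp [hM, Matrix.sum_apply]
    have him : ∀ r s, (M r s).im = ∑ i, w i * ((Y i * (Y i)ᴴ) r s).im := fun r s => by
      simp [hM, Matrix.sum_apply]
    have h5 : ∑ i, w i * (2 * b ^ 2 * (((Y i * (Y i)ᴴ) p p).re + ((Y i * (Y i)ᴴ) q q).re) +
        2 * b * c * (2 * ((Y i * (Y i)ᴴ) p q).im)) =
        2 * b ^ 2 * ((M p p).re + (M q q).re) + 2 * b * c * (2 * (M p q).im) := by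
      rw [hre, hre, him, ← Finset.sum_add_distrib]
      simp only [Finset.mul_sum, ← Finset.sum_add_distrib]
      exact Finset.sum_congr rfl fun i _ => by ring
    rw [h5] at h3
    simp only [mul_sub, Finset.sum_sub_distrib] at h3
    linarith
  have key2 : ∀ p q : α ⊕ α, p ≠ q → p.isLeft = q.isLeft → -(M p q).im ≤ ε := by
    intro p q hpq hl
    have hA : 0 ≤ (M p p).re + (M q q).re + ε := by
      have hd : ∀ p, 0 ≤ (M p p).re := fun p => by
        simp only [hM, Matrix.sum_apply, Complex.re_sum, Matrix.smul_apply, smul_eq_mul,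
          Complex.re_ofReal_mul]
        refine Finset.sum_nonneg fun i _ => mul_nonneg (hw i) ?_
        simp only [Matrix.mul_apply, conjTranspose_apply, Complex.re_sum, Complex.star_def,
          Complex.mul_conj, Complex.ofReal_re]
        exact Finset.sum_nonneg fun _ _ => Complex.normSq_nonneg _
      have := hd p; have := hd q; linarith
    by_contra! hlt
    have : -(2 * (M p q).im) - ε ≤ 0 := by
      refine nonpos_of_forall_le_mul (c := (M p p).re + (M q q).re + ε) fun δ hδ => ?_
      obtain ⟨c, hc, h0⟩ := key p q hpq hl δ
      rw [abs_of_pos hδ] at h0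
      have h1 : 0 ≤ 2 * δ * (δ * ((M p p).re + (M q q).re + ε) -
          c * (-(2 * (M p q).im) - ε)) := by linarith
      have h2 := nonneg_of_mul_nonneg_right h1 (by positivity)
      have h3 : 0 ≤ -(2 * (M p q).im) - ε := by linarith
      nlinarith
    linarith
  intro p q hl
  rcases eq_or_ne p q with rfl | hpq
  · have := congrArg Complex.im (hMH p p)
    rw [Complex.star_def, Complex.conj_im] at this
    have : (M p p).im = 0 := by linarith
    rw [this, abs_zero]; exact hε.le
  · rw [abs_le]
    have h1 := key2 p q hpq hl
    have h2 := key2 q p hpq.symm hl.symm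
    rw [hMH p q, Complex.star_def, Complex.conj_im] at h2
    constructor <;> linarith

end Critical

section Generic

open Polynomial

theorem exists_ringEquiv_of_transcendental (K : Subfield ℂ) {z z' : ℂ}
    (hz : Transcendental K z) (hz' : Transcendental K z') :
    ∃ σ : ℂ ≃+* ℂ, (∀ a : K, σ a = a) ∧ σ z = z' := by
  have hb : ∀ {z : ℂ}, Transcendental K z → ∃ t : Set ℂ, z ∈ t ∧
      IsTranscendenceBasis K ((↑) : t → ℂ) := fun {z} hz => by
    obtain ⟨t, ht, hbt⟩ := exists_isTranscendenceBasis_superset (R := K) (s := {z})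
      (algebraicIndependent_unique_type_iff.mpr hz)
    exact ⟨t, ht rfl, hbt⟩
  obtain ⟨t, hzt, hv⟩ := hb hz
  obtain ⟨t', hzt', hw⟩ := hb hz'
  obtain ⟨e₀⟩ := Cardinal.eq.mp (hv.cardinalMk_eq_trdeg.trans hw.cardinalMk_eq_trdeg.symm)
  set e : t ≃ t' := e₀.trans (Equiv.swap (e₀ ⟨z, hzt⟩) ⟨z', hzt'⟩) with he
  have hez : e ⟨z, hzt⟩ = ⟨z', hzt'⟩ := by simp [he]
  have := IsAlgClosed.isAlgClosure_of_transcendence_basis _ hv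
  have := IsAlgClosed.isAlgClosure_of_transcendence_basis _ hw
  set ε := (hv.1.aevalEquiv.symm.trans
    ((MvPolynomial.renameEquiv K e).trans hw.1.aevalEquiv)) with hε
  have key : ∀ p : MvPolynomial t K, IsAlgClosure.equivOfEquiv ℂ ℂ ε.toRingEquiv
      (MvPolynomial.aeval ((↑) : t → ℂ) p) =
      MvPolynomial.aeval ((↑) : t' → ℂ) (MvPolynomial.rename e p) := fun p => by
    have h := IsAlgClosure.equivOfEquiv_algebraMap ℂ ℂ ε.toRingEquiv (hv.1.aevalEquiv p)
    have h2 : ε.toRingEquiv (hv.1.aevalEquiv p) = hw.1.aevalEquiv (MvPolynomial.rename e p) := by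
      change ε (hv.1.aevalEquiv p) = _
      simp [hε]
    rw [h2, hv.1.algebraMap_aevalEquiv, hw.1.algebraMap_aevalEquiv] at h
    exact h
  refine ⟨IsAlgClosure.equivOfEquiv ℂ ℂ ε.toRingEquiv, fun a => ?_, ?_⟩
  · have := key (MvPolynomial.C a)
    simp only [MvPolynomial.rename_C, MvPolynomial.aeval_C] at this
    exact this
  · have := key (MvPolynomial.X ⟨z, hzt⟩)
    simpa [hez] using this

variable {α I : Type*} [Fintype α] [DecidableEq α] [Fintype I] {κ : I → Type*}
  [∀ i, Fintype (κ i)]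

/-- Along a polynomial family of configurations, semistability at one parameter propagates to all
parameters that are transcendental over the field of coefficients. -/
theorem Semistable.of_transcendental {T : ∀ i, Matrix (α ⊕ α) (κ i) ℂ[X]} {w : I → ℝ}
    (hw : ∀ i, 0 ≤ w i) {a : ℂ} (h : Semistable (fun i => (T i).map (eval a)) w)
    (K : Subfield ℂ) [Countable K] (hK : ∀ i p j k, ((T i) p j).coeff k ∈ K) {z : ℂ}
    (hz : Transcendental K z) : Semistable (fun i => (T i).map (eval z)) w := by
  have hev := h.eventually (T := fun x i => (T i).map (eval x)) hw (fun i => by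
    refine continuous_matrix fun p j => ?_
    exact ((T i) p j).continuous)
  have hd : Dense {x : ℂ | IsAlgebraic K x}ᶜ := (Algebraic.countable K ℂ).dense_compl ℂ
  obtain ⟨z', hz', hs⟩ := (hd.inter_nhds_nonempty hev)
  obtain ⟨σ, hσ, hσz⟩ := exists_ringEquiv_of_transcendental K hz hz'
  refine Semistable.of_map hw hs (σ : ℂ →+* ℂ) fun i => ?_
  ext p j
  simp only [Matrix.map_apply, RingEquiv.coe_toRingHom, eval_eq_sum_range, map_sum, map_mul,
    map_pow, hσz]
  refine Finset.sum_congr rfl fun k _ => ?_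
  rw [hσ ⟨_, hK i p j k⟩]

theorem exists_semistable_of_semistable [∀ i, Countable (κ i)]
    {T : ∀ i, Matrix (α ⊕ α) (κ i) ℂ[X]} {w w' : I → ℝ}
    (hw : ∀ i, 0 ≤ w i) (hw' : ∀ i, 0 ≤ w' i) {a a' : ℂ}
    (h : Semistable (fun i => (T i).map (eval a)) w)
    (h' : Semistable (fun i => (T i).map (eval a')) w') :
    ∃ z, Semistable (fun i => (T i).map (eval z)) w ∧
      Semistable (fun i => (T i).map (eval z)) w' := by
  set S : Set ℂ := Set.range fun x : (Σ i, (α ⊕ α) × κ i × ℕ) =>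
    ((T x.1) x.2.1 x.2.2.1).coeff x.2.2.2 with hS
  have : Countable (Subfield.closure S) := by
    rw [← Cardinal.mk_le_aleph0_iff]
    refine (Subfield.cardinalMk_closure_le_max S).trans (max_le ?_ le_rfl)
    exact Cardinal.le_aleph0_iff_set_countable.mpr (Set.countable_range _)
  have hK : ∀ i p j k, ((T i) p j).coeff k ∈ Subfield.closure S := fun i p j k =>
    Subfield.subset_closure ⟨⟨i, p, j, k⟩, rfl⟩
  have hd : Dense {x : ℂ | IsAlgebraic (Subfield.closure S) x}ᶜ :=
    (Algebraic.countable _ ℂ).dense_compl ℂ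
  obtain ⟨z, hz⟩ := hd.nonempty
  exact ⟨z, h.of_transcendental hw _ hK hz, h'.of_transcendental hw' _ hK hz⟩

/-- The reflection in the hyperplane orthogonal to `v`, scaled by `v ⬝ᵥ v`. -/
def scaledReflection {R m : Type*} [CommRing R] [Fintype m] [DecidableEq m] (v : m → R) :
    Matrix m m R := (v ⬝ᵥ v) • (1 : Matrix m m R) - (2 : R) • vecMulVec v v

variable {m : Type*} [Fintype m] [DecidableEq m]

theorem scaledReflection_transpose_mul_self {R : Type*} [CommRing R] (v : m → R) :
    (scaledReflection v)ᵀ * scaledReflection v = ((v ⬝ᵥ v) ^ 2) • (1 : Matrix m m R) := by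
  have h : vecMulVec v v * vecMulVec v v = (v ⬝ᵥ v) • vecMulVec v v := by
    rw [vecMulVec_mul_vecMulVec, vecMulVec_smul]
  have ht : (vecMulVec v v)ᵀ = vecMulVec v v := transpose_vecMulVec v v
  simp only [scaledReflection, transpose_sub, transpose_smul, transpose_one, ht, Matrix.sub_mul,
    Matrix.mul_sub, Matrix.smul_mul, Matrix.mul_smul, Matrix.one_mul, Matrix.mul_one, h]
  module

theorem scaledReflection_mulVec {R : Type*} [CommRing R] (v x : m → R) :
    scaledReflection v *ᵥ x = (v ⬝ᵥ v) • x - (2 * (v ⬝ᵥ x)) • v := by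
  rw [scaledReflection, sub_mulVec, smul_mulVec, smul_mulVec, one_mulVec, vecMulVec_mulVec]
  ext i; simp; ring

theorem scaledReflection_map {R S : Type*} [CommRing R] [CommRing S] (f : R →+* S) (v : m → R) :
    (scaledReflection v).map f = scaledReflection (f ∘ v) := by
  ext i j
  simp [scaledReflection, Matrix.one_apply, vecMulVec_apply, dotProduct, apply_ite f, map_ofNat f 2]

theorem exists_polynomial_path_of_reflections {k : m → ℝ} (hk : k ⬝ᵥ k = 1)
    (l : List (EuclideanSpace ℝ m)) :
    ∃ (P : Matrix m m ℂ[X]) (q : ℂ[X]), Pᵀ * P = q • (1 : Matrix m m ℂ[X]) ∧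
      (∀ x : m → ℂ, (fun p => (k p : ℂ)) ⬝ᵥ x = 0 → P.map (eval 0) *ᵥ x = x) ∧
      ∀ x : EuclideanSpace ℝ m, P.map (eval 1) *ᵥ (fun p => (x p : ℂ)) =
        fun p => (((l.map fun v => (Submodule.span ℝ {v})ᗮ.reflection).prod x p : ℝ) : ℂ) := by
  induction l with
  | nil =>
    refine ⟨1, 1, by simp, fun x _ => ?_, fun x => ?_⟩
    · rw [Matrix.map_one _ eval_zero eval_one, one_mulVec]
    · rw [Matrix.map_one _ eval_zero eval_one, one_mulVec]; simp
  | cons v l ih =>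
    obtain ⟨P, q, hP, h0, h1⟩ := ih
    rcases eq_or_ne v 0 with rfl | hv
    · refine ⟨P, q, hP, h0, fun x => ?_⟩
      rw [h1, List.map_cons, List.prod_cons, LinearIsometryEquiv.coe_mul, Function.comp_apply,
        Submodule.reflection_orthogonal_apply, Submodule.reflection_singleton_apply]
      simp
    · set u : EuclideanSpace ℝ m := ‖v‖⁻¹ • v with hu
      set r : m → ℂ[X] := fun p => (1 - X) * C (k p : ℂ) + X * C (u p : ℂ) with hr
      have e0 : (evalRingHom (0 : ℂ)) ∘ r = fun p => (k p : ℂ) := by ext p; simp [hr]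
      have e1 : (evalRingHom (1 : ℂ)) ∘ r = fun p => (u p : ℂ) := by ext p; simp [hr]
      have hmap : ∀ z : ℂ, (scaledReflection r * P).map (eval z) =
          scaledReflection (evalRingHom z ∘ r) * P.map (eval z) := fun z => by
        rw [← coe_evalRingHom, Matrix.map_mul, scaledReflection_map]
      refine ⟨scaledReflection r * P, (r ⬝ᵥ r) ^ 2 * q, ?_, fun x hx => ?_, fun x => ?_⟩
      · rw [transpose_mul, Matrix.mul_assoc, ← Matrix.mul_assoc _ _ P,
          scaledReflection_transpose_mul_self, Matrix.smul_mul, Matrix.one_mul, Matrix.mul_smul,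
          hP, smul_smul]
      · rw [hmap, ← mulVec_mulVec, h0 x hx, e0, scaledReflection_mulVec, hx]
        have : (fun p => (k p : ℂ)) ⬝ᵥ (fun p => (k p : ℂ)) = 1 := by
          have := congrArg (Complex.ofReal) hk
          simpa [dotProduct] using this
        rw [this]; simp
      · rw [hmap, ← mulVec_mulVec, h1 x, e1, scaledReflection_mulVec, List.map_cons,
          List.prod_cons, LinearIsometryEquiv.coe_mul, Function.comp_apply]
        set y := (l.map fun v => (Submodule.span ℝ {v})ᗮ.reflection).prod x
        have hn : ‖v‖ ≠ 0 := norm_ne_zero_iff.mpr hv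
        have huu : (fun p => (u p : ℂ)) ⬝ᵥ (fun p => (u p : ℂ)) = 1 := by
          have : ‖u‖ ^ 2 = 1 := by rw [hu, norm_smul, norm_inv, norm_norm, inv_mul_cancel₀ hn]; simp
          rw [EuclideanSpace.norm_sq_eq] at this
          have := congrArg (Complex.ofReal) this
          simpa [dotProduct, pow_two] using this
        have huy : (fun p => (u p : ℂ)) ⬝ᵥ (fun p => (y p : ℂ)) =
            ((‖v‖⁻¹ * inner ℝ v y : ℝ) : ℂ) := by
          rw [← real_inner_smul_left, ← hu, PiLp.inner_apply, Complex.ofReal_sum]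
          simp [dotProduct, mul_comm]
        rw [huu, huy, Submodule.reflection_orthogonal_apply, Submodule.reflection_singleton_apply]
        ext p
        simp [hu]
        field_simp

/-- Two real orthonormal frames are joined by a polynomial path of complex frames that are
conformally orthonormal for the bilinear form. -/
theorem exists_polynomial_path {ι : Type*} [Fintype ι] [DecidableEq ι] [Nonempty ι]
    {O₀ O₁ : Matrix (ι ⊕ ι) ι ℝ} (h₀ : O₀ᵀ * O₀ = 1) (h₁ : O₁ᵀ * O₁ = 1) :
    ∃ (P : Matrix (ι ⊕ ι) ι ℂ[X]) (q : ℂ[X]), Pᵀ * P = q • (1 : Matrix ι ι ℂ[X]) ∧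
      P.map (eval 0) = O₀.map Complex.ofReal ∧ P.map (eval 1) = O₁.map Complex.ofReal := by
  have hbasis : ∀ {O : Matrix (ι ⊕ ι) ι ℝ}, Oᵀ * O = 1 →
      ∃ b : OrthonormalBasis (ι ⊕ ι) ℝ (EuclideanSpace ℝ (ι ⊕ ι)),
        ∀ i p, b (Sum.inl i) p = O p i := fun {O} h => by
    have hon : Orthonormal ℝ ((Set.range Sum.inl).domRestrict
        (fun x : ι ⊕ ι => WithLp.toLp 2 fun p => Sum.elim (O p) (fun _ => 0) x)) := by
      rw [orthonormal_iff_ite]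
      rintro ⟨_, i, rfl⟩ ⟨_, j, rfl⟩
      have := congrFun (congrFun h i) j
      simp only [Matrix.mul_apply, transpose_apply, Matrix.one_apply] at this
      simp only [Set.domRestrict_apply, PiLp.inner_apply, Sum.elim_inl, Subtype.ext_iff,
        Sum.inl.injEq]
      simpa [mul_comm] using this
    obtain ⟨b, hb⟩ := hon.exists_orthonormalBasis_extension_of_card_eq (by simp)
    exact ⟨b, fun i p => by rw [hb _ ⟨i, rfl⟩]; rfl⟩
  obtain ⟨b₀, hb₀⟩ := hbasis h₀
  obtain ⟨b₁, hb₁⟩ := hbasis h₁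
  obtain ⟨l, -, hl⟩ := (b₀.equiv b₁ (Equiv.refl _)).reflections_generate_dim
  obtain ⟨i₀⟩ := ‹Nonempty ι›
  set k : EuclideanSpace ℝ (ι ⊕ ι) := b₀ (Sum.inr i₀) with hk
  have hkk : (fun p => k p) ⬝ᵥ (fun p => k p) = 1 := by
    have := b₀.orthonormal.1 (Sum.inr i₀)
    have h2 : ‖k‖ ^ 2 = 1 := by rw [hk, this]; norm_num
    rw [EuclideanSpace.norm_sq_eq] at h2
    simpa [dotProduct, pow_two] using h2
  obtain ⟨P, q, hP, hP0, hP1⟩ := exists_polynomial_path_of_reflections hkk l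
  rw [← hl] at hP1
  have hmapmul : ∀ z : ℂ, (P * O₀.map fun x => C (x : ℂ)).map (eval z) =
      P.map (eval z) * O₀.map Complex.ofReal := fun z => by
    rw [← coe_evalRingHom, Matrix.map_mul]
    congr 1; ext i j; simp
  refine ⟨P * O₀.map fun x => C (x : ℂ), q, ?_, ?_, ?_⟩
  · have : (O₀.map fun x => C (x : ℂ))ᵀ * (O₀.map fun x => C (x : ℂ)) = 1 := by
      have := congrArg (fun A : Matrix ι ι ℝ => A.map (C.comp Complex.ofRealHom)) h₀
      simp only [Matrix.map_mul, Matrix.map_one _ (map_zero _) (map_one _)] at this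
      exact this
    rw [transpose_mul, Matrix.mul_assoc, ← Matrix.mul_assoc _ P, hP, Matrix.smul_mul,
      Matrix.one_mul, Matrix.mul_smul, this]
  · rw [hmapmul]
    ext p j
    have := congrFun (hP0 (fun p => (O₀ p j : ℂ)) ?_) p
    · exact this
    · have : inner ℝ (b₀ (Sum.inr i₀)) (b₀ (Sum.inl j)) = (0 : ℝ) :=
        b₀.orthonormal.2 (show Sum.inr i₀ ≠ Sum.inl j by simp)
      rw [PiLp.inner_apply] at this
      have := congrArg (Complex.ofReal) this
      simpa [dotProduct, hb₀, mul_comm] using this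
  · rw [hmapmul]
    ext p j
    have h2 := congrFun (hP1 (b₀ (Sum.inl j))) p
    simp only [OrthonormalBasis.equiv_apply_basis, Equiv.refl_apply, hb₀, hb₁] at h2
    exact h2

end Generic

section Frames

variable {n : ℕ}

/-- The diagonal matrix of the normal form with frequencies `a`. -/
def normalForm {n : ℕ} (a : Fin n → ℝ) : Matrix (Fin n ⊕ Fin n) (Fin n ⊕ Fin n) ℝ :=
  diagonal (Sum.elim a a)

theorem normalForm_transpose (a : Fin n → ℝ) : (normalForm a)ᵀ = normalForm a :=
  diagonal_transpose _

theorem normalForm_mul (a b : Fin n → ℝ) :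
    normalForm a * normalForm b = normalForm (a * b) := by
  rw [normalForm, normalForm, diagonal_mul_diagonal, normalForm]
  congr 1; ext (i | i) <;> rfl

theorem Omega_mul_normalForm (a : Fin n → ℝ) :
    Omega n * normalForm a = normalForm a * Omega n := by
  ext (i | i) (j | j) <;>
    simp [Omega, normalForm, mul_diagonal, diagonal_mul, Matrix.one_apply] <;> grind

theorem normalForm_mul_Omega_mul (a : Fin n → ℝ) :
    normalForm a * Omega n * normalForm a = Omega n * normalForm (a * a) := by
  rw [← Omega_mul_normalForm, Matrix.mul_assoc, normalForm_mul]

theorem isUnit_det_normalForm {a : Fin n → ℝ} (ha : ∀ j, 0 < a j) :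
    IsUnit (normalForm a).det := by
  rw [normalForm, det_diagonal, isUnit_iff_ne_zero, Finset.prod_ne_zero_iff]
  rintro (i | i) - <;> exact (ha i).ne'

theorem Omega_eq_neg_J : Omega n = -J (Fin n) ℝ := by
  ext (i | i) (j | j) <;> simp [Omega, J]

theorem isUnit_det_Omega : IsUnit (Omega n).det := by
  rw [Omega_eq_neg_J, ← J_inv, isUnit_nonsing_inv_det_iff]
  exact isUnit_det_J _ _

theorem mem_Sp_iff {S : Matrix (Fin n ⊕ Fin n) (Fin n ⊕ Fin n) ℝ} :
    S ∈ Sp n ↔ S ∈ symplecticGroup (Fin n) ℝ := by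
  rw [SymplecticGroup.mem_iff', Sp, Set.mem_ofPred_eq, Omega_eq_neg_J, Matrix.mul_neg,
    Matrix.neg_mul, neg_inj]

theorem mul_Omega_mul_transpose_of_mem_Sp {S : Matrix (Fin n ⊕ Fin n) (Fin n ⊕ Fin n) ℝ}
    (hS : S ∈ Sp n) : S * Omega n * Sᵀ = Omega n := by
  rw [mem_Sp_iff, SymplecticGroup.mem_iff] at hS
  rw [Omega_eq_neg_J, Matrix.mul_neg, Matrix.neg_mul, hS]

theorem mem_Sp_of_mul_Omega_mul_transpose {S : Matrix (Fin n ⊕ Fin n) (Fin n ⊕ Fin n) ℝ}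
    (hS : S * Omega n * Sᵀ = Omega n) : S ∈ Sp n := by
  rw [mem_Sp_iff, SymplecticGroup.mem_iff]
  rwa [Omega_eq_neg_J, Matrix.mul_neg, Matrix.neg_mul, neg_inj] at hS

theorem isUnit_det_of_mem_Sp {S : Matrix (Fin n ⊕ Fin n) (Fin n ⊕ Fin n) ℝ}
    (hS : S ∈ Sp n) : IsUnit S.det :=
  SymplecticGroup.symplectic_det (mem_Sp_iff.mp hS)

theorem sqrt_mul_sqrt_of_pos {a : Fin n → ℝ} (ha : ∀ j, 0 < a j) :
    (fun j => √(a j)) * (fun j => √(a j)) = a :=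
  funext fun j => Real.mul_self_sqrt (ha j).le

theorem hasFrequencies.exists_factor {H : Matrix (Fin n ⊕ Fin n) (Fin n ⊕ Fin n) ℝ}
    {a : Fin n → ℝ} (ha : ∀ j, 0 < a j) (h : hasFrequencies n H a) :
    ∃ M : Matrix (Fin n ⊕ Fin n) (Fin n ⊕ Fin n) ℝ,
      Mᵀ * M = H ∧ M * Omega n * Mᵀ = Omega n * normalForm a := by
  obtain ⟨S, hS, hSH⟩ := h
  have hu := isUnit_det_of_mem_Sp hS
  have hut : IsUnit Sᵀ.det := by rwa [det_transpose]
  set R := normalForm fun j => √(a j) with hR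
  have hRR : R * R = normalForm a := by rw [hR, normalForm_mul, sqrt_mul_sqrt_of_pos ha]
  have hinv : S⁻¹ * Omega n * (S⁻¹)ᵀ = Omega n := by
    conv_lhs => rw [← mul_Omega_mul_transpose_of_mem_Sp hS]
    rw [transpose_nonsing_inv, Matrix.mul_assoc S, nonsing_inv_mul_cancel_left _ _ hu,
      mul_nonsing_inv_cancel_right _ _ hut]
  refine ⟨R * S⁻¹, ?_, ?_⟩
  · rw [transpose_mul, hR, normalForm_transpose, ← hR, Matrix.mul_assoc, ← Matrix.mul_assoc R, hRR,
      show normalForm a = _ from hSH.symm, mul_nonsing_inv_cancel_right _ _ hu,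
      transpose_nonsing_inv, nonsing_inv_mul_cancel_left _ _ hut]
  · rw [transpose_mul, hR, normalForm_transpose, ← hR]
    calc R * S⁻¹ * Omega n * ((S⁻¹)ᵀ * R) = R * (S⁻¹ * Omega n * (S⁻¹)ᵀ) * R := by
          simp only [Matrix.mul_assoc]
      _ = _ := by rw [hinv, hR, normalForm_mul_Omega_mul, sqrt_mul_sqrt_of_pos ha]

theorem posDef_and_hasFrequencies_of_factor {M : Matrix (Fin n ⊕ Fin n) (Fin n ⊕ Fin n) ℝ}
    {a : Fin n → ℝ} (ha : ∀ j, 0 < a j) (hM : M * Omega n * Mᵀ = Omega n * normalForm a) :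
    (Mᵀ * M).PosDef ∧ hasFrequencies n (Mᵀ * M) a := by
  have hu : IsUnit M.det := by
    have h := (isUnit_det_Omega (n := n)).mul (isUnit_det_normalForm ha)
    rw [← det_mul, ← hM, det_mul] at h
    exact isUnit_of_mul_isUnit_right (by rwa [det_transpose] at h)
  have hut : IsUnit Mᵀ.det := by rwa [det_transpose]
  refine ⟨?_, ?_⟩
  · have := PosDef.conjTranspose_mul_self M
      (mulVec_injective_of_isUnit ((isUnit_iff_isUnit_det M).mpr hu))
    rwa [conjTranspose_eq_transpose_of_trivial] at this
  · set R := normalForm fun j => √(a j) with hR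
    have hRR : R * R = normalForm a := by rw [hR, normalForm_mul, sqrt_mul_sqrt_of_pos ha]
    have hRt : Rᵀ = R := normalForm_transpose _
    refine ⟨M⁻¹ * R, mem_Sp_of_mul_Omega_mul_transpose ?_, ?_⟩
    · rw [transpose_mul, hRt]
      calc M⁻¹ * R * Omega n * (R * (M⁻¹)ᵀ) = M⁻¹ * (R * Omega n * R) * (M⁻¹)ᵀ := by
            simp only [Matrix.mul_assoc]
        _ = _ := by
            rw [hR, normalForm_mul_Omega_mul, sqrt_mul_sqrt_of_pos ha, ← hM, transpose_nonsing_inv,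
              Matrix.mul_assoc M, nonsing_inv_mul_cancel_left _ _ hu,
              mul_nonsing_inv_cancel_right _ _ hut]
    · rw [transpose_mul, hRt, ← normalForm, ← hRR, transpose_nonsing_inv]
      calc R * Mᵀ⁻¹ * (Mᵀ * M) * (M⁻¹ * R) = R * (Mᵀ⁻¹ * (Mᵀ * (M * (M⁻¹ * R)))) := by
            simp only [Matrix.mul_assoc]
        _ = _ := by
            rw [mul_nonsing_inv_cancel_left _ _ hu, nonsing_inv_mul_cancel_left _ _ hut]

/-- Frequencies of sums in terms of orthonormal frames: the stacked frame `O` intertwines the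
Poisson structure of the normal form of the sum with those of the summands. -/
def FrameCompatible (a b c : Fin n → ℝ)
    (O : Matrix ((Fin n ⊕ Fin n) ⊕ (Fin n ⊕ Fin n)) (Fin n ⊕ Fin n) ℝ) : Prop :=
  Oᵀ * O = 1 ∧ O.toRows₁ * (Omega n * normalForm c) * O.toRows₁ᵀ = Omega n * normalForm a ∧
    O.toRows₂ * (Omega n * normalForm c) * O.toRows₂ᵀ = Omega n * normalForm b

theorem transpose_mul_self_eq_toRows {m₁ m₂ k R : Type*} [Fintype m₁] [Fintype m₂]
    [CommRing R] (O : Matrix (m₁ ⊕ m₂) k R) :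
    Oᵀ * O = O.toRows₁ᵀ * O.toRows₁ + O.toRows₂ᵀ * O.toRows₂ := by
  ext i j
  simp [Matrix.mul_apply]

theorem exists_sum_hasFrequencies_iff {a b c : Fin n → ℝ} (ha : ∀ j, 0 < a j)
    (hb : ∀ j, 0 < b j) (hc : ∀ j, 0 < c j) :
    (∃ H₁ H₂ : Matrix (Fin n ⊕ Fin n) (Fin n ⊕ Fin n) ℝ, H₁.PosDef ∧ H₂.PosDef ∧
      hasFrequencies n H₁ a ∧ hasFrequencies n H₂ b ∧ hasFrequencies n (H₁ + H₂) c) ↔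
      ∃ O, FrameCompatible a b c O := by
  set R := normalForm fun j => √(c j) with hR
  have hRR : R * R = normalForm c := by rw [hR, normalForm_mul, sqrt_mul_sqrt_of_pos hc]
  have hRt : Rᵀ = R := normalForm_transpose _
  have hRu : IsUnit R.det := isUnit_det_normalForm fun j => Real.sqrt_pos.mpr (hc j)
  have hRO : R * Omega n * R = Omega n * normalForm c := by
    rw [hR, normalForm_mul_Omega_mul, sqrt_mul_sqrt_of_pos hc]
  constructor
  · rintro ⟨H₁, H₂, -, -, h₁, h₂, S, hS, hSH⟩
    obtain ⟨M₁, hM₁, hM₁'⟩ := h₁.exists_factor ha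
    obtain ⟨M₂, hM₂, hM₂'⟩ := h₂.exists_factor hb
    have key : ∀ M : Matrix (Fin n ⊕ Fin n) (Fin n ⊕ Fin n) ℝ,
        M * S * R⁻¹ * (Omega n * normalForm c) * (M * S * R⁻¹)ᵀ = M * Omega n * Mᵀ := fun M => by
      calc M * S * R⁻¹ * (Omega n * normalForm c) * (M * S * R⁻¹)ᵀ
          = M * (S * (R⁻¹ * (R * (Omega n * (R * (R⁻¹ * (Sᵀ * Mᵀ))))))) := by
            rw [← hRO, transpose_mul, transpose_mul, transpose_nonsing_inv, hRt]
            simp only [Matrix.mul_assoc]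
        _ = M * (S * Omega n * Sᵀ) * Mᵀ := by
            rw [nonsing_inv_mul_cancel_left _ _ hRu, mul_nonsing_inv_cancel_left _ _ hRu]
            simp only [Matrix.mul_assoc]
        _ = _ := by rw [mul_Omega_mul_transpose_of_mem_Sp hS]
    refine ⟨fromRows (M₁ * S * R⁻¹) (M₂ * S * R⁻¹), ?_, ?_, ?_⟩
    · rw [transpose_mul_self_eq_toRows, toRows₁_fromRows, toRows₂_fromRows]
      calc (M₁ * S * R⁻¹)ᵀ * (M₁ * S * R⁻¹) + (M₂ * S * R⁻¹)ᵀ * (M₂ * S * R⁻¹)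
          = R⁻¹ * (Sᵀ * (M₁ᵀ * M₁ + M₂ᵀ * M₂) * S) * R⁻¹ := by
            simp only [transpose_mul, transpose_nonsing_inv, hRt, Matrix.mul_assoc, Matrix.mul_add,
              Matrix.add_mul]
        _ = _ := by
            rw [hM₁, hM₂, hSH, ← normalForm, ← hRR, nonsing_inv_mul_cancel_left _ _ hRu,
              mul_nonsing_inv _ hRu]
    · rw [toRows₁_fromRows, key, hM₁']
    · rw [toRows₂_fromRows, key, hM₂']
  · rintro ⟨O, hO, h₁, h₂⟩
    have key : ∀ A : Matrix (Fin n ⊕ Fin n) (Fin n ⊕ Fin n) ℝ,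
        A * R * Omega n * (A * R)ᵀ = A * (Omega n * normalForm c) * Aᵀ := fun A => by
      rw [← hRO, transpose_mul, hRt]
      simp only [Matrix.mul_assoc]
    obtain ⟨p₁, f₁⟩ := posDef_and_hasFrequencies_of_factor ha ((key _).trans h₁)
    obtain ⟨p₂, f₂⟩ := posDef_and_hasFrequencies_of_factor hb ((key _).trans h₂)
    refine ⟨_, _, p₁, p₂, f₁, f₂, 1, by simp [Sp], ?_⟩
    rw [← normalForm, ← hRR]
    calc 1ᵀ * ((O.toRows₁ * R)ᵀ * (O.toRows₁ * R) + (O.toRows₂ * R)ᵀ * (O.toRows₂ * R)) * 1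
        = R * (O.toRows₁ᵀ * O.toRows₁ + O.toRows₂ᵀ * O.toRows₂) * R := by
          simp only [transpose_mul, transpose_one, hRt, Matrix.mul_assoc, Matrix.mul_add,
            Matrix.add_mul, Matrix.one_mul, Matrix.mul_one]
      _ = _ := by rw [← transpose_mul_self_eq_toRows, hO, Matrix.mul_one]

theorem FrameCompatible.ne_zero {a b c : Fin n → ℝ} (ha : ∀ j, 0 < a j) {O}
    (h : FrameCompatible a b c O) (j : Fin n) : c j ≠ 0 := by
  have hu := (isUnit_det_Omega (n := n)).mul (isUnit_det_normalForm ha)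
  rw [← det_mul, ← h.2.1, det_mul, det_mul, det_mul] at hu
  have h1 :=
    (isUnit_of_mul_isUnit_right (isUnit_of_mul_isUnit_right (isUnit_of_mul_isUnit_left hu)))
  rw [normalForm, det_diagonal, isUnit_iff_ne_zero, Finset.prod_ne_zero_iff] at h1
  exact h1 (Sum.inl j) (Finset.mem_univ _)

theorem isClosed_setOf_frameCompatible (a b : Fin n → ℝ) :
    IsClosed {c : Fin n → ℝ | ∃ O, FrameCompatible a b c O} := by
  set K : Set (Matrix ((Fin n ⊕ Fin n) ⊕ (Fin n ⊕ Fin n)) (Fin n ⊕ Fin n) ℝ) :=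
    {A | ∀ i j, ‖A i j‖ ≤ 1}
  have : CompactSpace K := isCompact_iff_compactSpace.mp (isCompact_setOf_norm_apply_le 1)
  have hcl : IsClosed {x : K × (Fin n → ℝ) | FrameCompatible a b x.2 x.1} := by
    have hr₁ : Continuous fun x : K × (Fin n → ℝ) => x.1.1.toRows₁ :=
      continuous_matrix fun i j =>
        continuous_subtype_val.fst'.matrix_elem (Sum.inl i) j
    have hr₂ : Continuous fun x : K × (Fin n → ℝ) => x.1.1.toRows₂ :=
      continuous_matrix fun i j =>
        continuous_subtype_val.fst'.matrix_elem (Sum.inr i) j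
    have hn : Continuous fun x : K × (Fin n → ℝ) => normalForm x.2 := by
      refine Continuous.matrix_diagonal (continuous_pi fun i => ?_)
      rcases i with i | i <;> simp only [Sum.elim_inl, Sum.elim_inr] <;> fun_prop
    simp only [FrameCompatible, Set.ofPred_and]
    refine .inter ?_ (.inter ?_ ?_) <;> exact isClosed_eq (by fun_prop) (by fun_prop)
  convert isClosedMap_snd_of_compactSpace _ hcl using 1
  ext c
  constructor
  · rintro ⟨O, hO⟩
    refine ⟨(⟨O, fun i j => norm_apply_le_one_of_diag O (fun j => ?_) i j⟩, c), hO, rfl⟩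
    rw [conjTranspose_eq_transpose_of_trivial, hO.1, one_apply_eq]
  · rintro ⟨⟨O, c'⟩, hO, rfl⟩
    exact ⟨O, hO⟩

theorem setOf_frequencies_eq {a b : Fin n → ℝ} (ha : ∀ j, 0 < a j) (hb : ∀ j, 0 < b j) :
    {c : Fin n → ℝ | Monotone c ∧ (∀ j, 0 < c j) ∧
      ∃ H₁ H₂ : Matrix (Fin n ⊕ Fin n) (Fin n ⊕ Fin n) ℝ, H₁.PosDef ∧ H₂.PosDef ∧
        hasFrequencies n H₁ a ∧ hasFrequencies n H₂ b ∧ hasFrequencies n (H₁ + H₂) c} =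
      {c | Monotone c ∧ (∀ j, 0 ≤ c j) ∧ ∃ O, FrameCompatible a b c O} := by
  ext c
  constructor
  · rintro ⟨hm, hp, h⟩
    exact ⟨hm, fun j => (hp j).le, (exists_sum_hasFrequencies_iff ha hb hp).mp h⟩
  · rintro ⟨hm, hp, O, hO⟩
    have hp' : ∀ j, 0 < c j := fun j => (hp j).lt_of_ne' (hO.ne_zero ha j)
    exact ⟨hm, hp', (exists_sum_hasFrequencies_iff ha hb hp').mpr ⟨O, hO⟩⟩

theorem isClosed_setOf_monotone_frameCompatible (a b : Fin n → ℝ) :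
    IsClosed {c : Fin n → ℝ | Monotone c ∧ (∀ j, 0 ≤ c j) ∧ ∃ O, FrameCompatible a b c O} := by
  refine isClosed_monotone.inter (.inter ?_ (isClosed_setOf_frameCompatible a b))
  exact isClosed_Ici (a := (0 : Fin n → ℝ))

end Frames

section ComplexFrames

variable {m : Type*} {n : ℕ}

/-- The real frame whose columns are the scaled real parts and negated imaginary parts of the
columns of `Y`. -/
noncomputable def realFrame (Y : Matrix m (Fin n) ℂ) : Matrix m (Fin n ⊕ Fin n) ℝ :=
  of fun p => Sum.elim (fun j => √2 * (Y p j).re) (fun j => -(√2 * (Y p j).im))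

/-- The orthonormal isotropic frame `(e_j - i e_{n+j}) / √2`. -/
noncomputable def isoFrame (n : ℕ) : Matrix (Fin n ⊕ Fin n) (Fin n) ℂ :=
  fromRows (((√2 : ℝ) : ℂ)⁻¹ • 1) ((-Complex.I * ((√2 : ℝ) : ℂ)⁻¹) • 1)

/-- The Hermitian matrix with orthonormal eigenvectors the columns of `Y` and eigenvalues `a`. -/
noncomputable def frameSum (Y : Matrix m (Fin n) ℂ) (a : Fin n → ℝ) : Matrix m m ℂ :=
  Y * diagonal (fun l => (a l : ℂ)) * Yᴴ

theorem frameSum_apply (Y : Matrix m (Fin n) ℂ) (a : Fin n → ℝ) (p q : m) :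
    frameSum Y a p q = ∑ l, Y p l * a l * star (Y q l) := by
  rw [frameSum, Matrix.mul_apply]
  simp [mul_diagonal]

theorem ofReal_sqrt_two_mul_self : ((√2 : ℝ) : ℂ) * ((√2 : ℝ) : ℂ) = 2 := by
  rw [← Complex.ofReal_mul, Real.mul_self_sqrt (by norm_num)]; norm_num

theorem ofReal_sqrt_two_ne_zero : ((√2 : ℝ) : ℂ) ≠ 0 := by simp

theorem isoFrame_conjTranspose_mul_self : (isoFrame n)ᴴ * isoFrame n = 1 := by
  have h := ofReal_sqrt_two_mul_self
  rw [isoFrame, conjTranspose_fromRows_eq_fromCols_conjTranspose, fromCols_mul_fromRows]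
  simp only [conjTranspose_smul, conjTranspose_one, Matrix.smul_mul, Matrix.one_mul, smul_smul,
    ← add_smul]
  rw [show star ((√2 : ℝ) : ℂ)⁻¹ = ((√2 : ℝ) : ℂ)⁻¹ by simp,
    show star (-Complex.I * ((√2 : ℝ) : ℂ)⁻¹) = Complex.I * ((√2 : ℝ) : ℂ)⁻¹ by simp]
  convert one_smul ℂ _ using 2
  have h0 := ofReal_sqrt_two_ne_zero
  have hI := Complex.I_mul_I
  field_simp
  linear_combination -hI - h

theorem isoFrame_transpose_mul_self : (isoFrame n)ᵀ * isoFrame n = 0 := by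
  rw [isoFrame, transpose_fromRows, fromCols_mul_fromRows]
  simp only [transpose_smul, transpose_one, Matrix.smul_mul, Matrix.one_mul, smul_smul,
    ← add_smul]
  convert zero_smul ℂ _ using 2
  linear_combination (((√2 : ℝ) : ℂ)⁻¹) ^ 2 * Complex.I_mul_I

theorem realFrame_map_mul {k : Type*} [Fintype k] (A : Matrix m k ℝ) (Y : Matrix k (Fin n) ℂ) :
    realFrame (A.map Complex.ofReal * Y) = A * realFrame Y := by
  ext p (j | j) <;>
    simp [realFrame, Matrix.mul_apply, Finset.mul_sum] <;>
    exact Finset.sum_congr rfl fun _ _ => by ring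

theorem realFrame_isoFrame : realFrame (isoFrame n) = 1 := by
  have h : √2 ≠ 0 := by simp
  ext (i | i) (j | j) <;>
    simp [realFrame, isoFrame, Matrix.one_apply, ← Complex.ofReal_inv] <;>
    split_ifs <;> simp <;> field_simp <;> simp

theorem realFrame_map_mul_isoFrame (A : Matrix m (Fin n ⊕ Fin n) ℝ) :
    realFrame (A.map Complex.ofReal * isoFrame n) = A := by
  rw [realFrame_map_mul, realFrame_isoFrame, Matrix.mul_one]

theorem realFrame_transpose_mul_self [Fintype m] {Y : Matrix m (Fin n) ℂ} (h : Yᴴ * Y = 1)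
    (h' : Yᵀ * Y = 0) : (realFrame Y)ᵀ * realFrame Y = 1 := by
  have h2 : √2 * √2 = 2 := Real.mul_self_sqrt (by norm_num)
  have e : ∀ i j, (∑ p, (Y p i).re * (Y p j).re) = (if i = j then 1 else 0) / 2 ∧
      (∑ p, (Y p i).im * (Y p j).im) = (if i = j then 1 else 0) / 2 ∧
      (∑ p, (Y p i).re * (Y p j).im) = 0 ∧ (∑ p, (Y p i).im * (Y p j).re) = 0 := fun i j => by
    have h1 := congrFun (congrFun h i) j
    have h1' := congrFun (congrFun h' i) j
    simp only [Matrix.mul_apply, conjTranspose_apply, transpose_apply, Matrix.one_apply,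
      Matrix.zero_apply] at h1 h1'
    have r := congrArg Complex.re h1
    have i1 := congrArg Complex.im h1
    have r' := congrArg Complex.re h1'
    have i' := congrArg Complex.im h1'
    simp [Finset.sum_sub_distrib, Finset.sum_add_distrib, apply_ite Complex.re,
      apply_ite Complex.im] at r i1 r' i'
    refine ⟨?_, ?_, ?_, ?_⟩ <;> linarith
  have h3 : ∀ x y : ℝ, √2 * x * (√2 * y) = 2 * (x * y) := fun x y => by
    linear_combination x * y * h2
  ext (i | i) (j | j) <;> obtain ⟨e1, e2, e3, e4⟩ := e i j <;>
    simp [realFrame, Matrix.mul_apply, h3, ← Finset.mul_sum, e1, e2, e3, e4, Matrix.one_apply,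
      mul_div_cancel₀]

theorem realFrame_mul_Omega_mul_apply (Y : Matrix m (Fin n) ℂ) (a : Fin n → ℝ) (p q : m) :
    (realFrame Y * (Omega n * normalForm a) * (realFrame Y)ᵀ) p q =
      2 * (frameSum Y a p q).im := by
  have h2 : √2 * √2 = 2 := Real.mul_self_sqrt (by norm_num)
  have hl : ∀ j, (realFrame Y * (Omega n * normalForm a)) p (Sum.inl j) =
      √2 * (Y p j).im * a j := fun j => by
    rw [← Matrix.mul_assoc, normalForm, mul_diagonal]
    simp [realFrame, Omega, Matrix.mul_apply, Matrix.one_apply]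
  have hr : ∀ j, (realFrame Y * (Omega n * normalForm a)) p (Sum.inr j) =
      √2 * (Y p j).re * a j := fun j => by
    rw [← Matrix.mul_assoc, normalForm, mul_diagonal]
    simp [realFrame, Omega, Matrix.mul_apply, Matrix.one_apply]
  rw [Matrix.mul_apply, Fintype.sum_sum_type, frameSum_apply, Complex.im_sum, Finset.mul_sum,
    ← Finset.sum_add_distrib]
  refine Finset.sum_congr rfl fun l _ => ?_
  rw [hl, hr]
  simp [realFrame]
  linear_combination ((Y p l).im * a l * (Y q l).re - (Y p l).re * a l * (Y q l).im) * h2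

end ComplexFrames

section Flags

variable {m : Type*} [Fintype m] {n : ℕ}

theorem exists_upperTriangular_orthonormal {A : Matrix m (Fin n) ℂ}
    (hA : Function.Injective A.mulVec) :
    ∃ R : Matrix (Fin n) (Fin n) ℂ, (∀ k l, l < k → R k l = 0) ∧ (A * R)ᴴ * (A * R) = 1 := by
  have hS : (Aᴴ * A).PosDef := .conjTranspose_mul_self A hA
  set L := LDL.lowerInv hS with hL
  have hD : (L * (Aᴴ * A) * Lᴴ).PosDef := hS.mul_mul_conjTranspose_same
    (vecMul_injective_of_isUnit (isUnit_of_invertible (LDL.lowerInv hS)))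
  rw [← LDL.diag_eq_lowerInv_conj, LDL.diag] at hD
  set d := LDL.diagEntries hS with hd
  have hpos : ∀ i, 0 < d i := posDef_diagonal_iff.mp hD
  have hr : ∀ i, 0 < (d i).re := fun i => (Complex.pos_iff.mp (hpos i)).1
  have hre : ∀ i, d i = ((d i).re : ℂ) := fun i =>
    Complex.ext (by simp) (by simpa using (Complex.pos_iff.mp (hpos i)).2.symm)
  set E : Matrix (Fin n) (Fin n) ℂ := diagonal fun i => (((√(d i).re)⁻¹ : ℝ) : ℂ) with hE
  have hEH : Eᴴ = E := by
    rw [hE, diagonal_conjTranspose]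
    congr 1; ext i; exact Complex.conj_ofReal _
  refine ⟨Lᴴ * E, fun k l hkl => ?_, ?_⟩
  · rw [hE, mul_diagonal, conjTranspose_apply, hL, LDL.lowerInv_triangular hS hkl]
    simp
  · calc (A * (Lᴴ * E))ᴴ * (A * (Lᴴ * E)) = E * (L * (Aᴴ * A) * Lᴴ) * E := by
          simp only [conjTranspose_mul, conjTranspose_conjTranspose, hEH, Matrix.mul_assoc]
      _ = 1 := by
          rw [hL, ← LDL.diag_eq_lowerInv_conj, LDL.diag, hE, diagonal_mul_diagonal,
            diagonal_mul_diagonal, ← diagonal_one]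
          congr 1; ext i
          have h1 : ((√(d i).re : ℝ) : ℂ) * ((√(d i).re : ℝ) : ℂ) = d i := by
            rw [← Complex.ofReal_mul, Real.mul_self_sqrt (hr i).le, ← hre]
          have h2 : ((√(d i).re : ℝ) : ℂ) ≠ 0 :=
            Complex.ofReal_ne_zero.mpr (Real.sqrt_pos.mpr (hr i)).ne'
          rw [← hd, Complex.ofReal_inv]
          nth_rw 2 [← h1]
          field_simp

theorem exists_lowerTriangular_orthonormal {A : Matrix m (Fin n) ℂ}
    (hA : Function.Injective A.mulVec) :
    ∃ R : Matrix (Fin n) (Fin n) ℂ, (∀ k l, k < l → R k l = 0) ∧ (A * R)ᴴ * (A * R) = 1 := by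
  obtain ⟨R, hR, hAR⟩ := exists_upperTriangular_orthonormal (A := A.submatrix id Fin.revPerm) (by
    intro x y hxy
    have := hA (a₁ := x ∘ Fin.revPerm) (a₂ := y ∘ Fin.revPerm)
      (by simpa [submatrix_mulVec_equiv] using hxy)
    exact Fin.revPerm.surjective.injective_comp_right this)
  refine ⟨R.submatrix Fin.revPerm Fin.revPerm, fun k l hkl => ?_, ?_⟩
  · exact hR _ _ (Fin.rev_lt_rev.mpr hkl)
  · have : A * R.submatrix Fin.revPerm Fin.revPerm =
        (A.submatrix id Fin.revPerm * R).submatrix id Fin.revPerm := by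
      rw [submatrix_mul _ _ _ Fin.revPerm _ Fin.revPerm.bijective]
      congr 1
      ext i j
      simp
    rw [this, conjTranspose_submatrix, ← submatrix_mul _ _ _ id _ Function.bijective_id, hAR]
    simp

/-- Successive differences of a tuple, the first one taken against zero. -/
def flagWeight (a : Fin n → ℝ) (j : Fin n) : ℝ :=
  a j - if h : (j : ℕ) = 0 then 0 else a ⟨j - 1, by omega⟩

theorem flagWeight_nonneg {a : Fin n → ℝ} (hm : Monotone a) (ha : ∀ j, 0 ≤ a j) (j : Fin n) :
    0 ≤ flagWeight a j := by
  rw [flagWeight]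
  split_ifs
  · simpa using ha j
  · exact sub_nonneg.mpr (hm (Fin.mk_le_of_le_val (by omega)))

theorem flagWeight_add_smul (a b : Fin n → ℝ) (s t : ℝ) (j : Fin n) :
    flagWeight (s • a + t • b) j = s * flagWeight a j + t * flagWeight b j := by
  simp only [flagWeight]
  split_ifs
  · simp
  · simp; ring

theorem sum_flagWeight (a : Fin n → ℝ) (l : Fin n) :
    ∑ j, (if j ≤ l then flagWeight a j else 0) = a l := by
  set f : ℕ → ℝ := fun k => if h : k ≠ 0 ∧ k - 1 < n then a ⟨k - 1, h.2⟩ else 0 with hf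
  have h1 : ∀ j : Fin n, flagWeight a j = f (j + 1) - f j := by
    rintro ⟨_ | k, hk⟩
    · simp [flagWeight, hf, hk]
    · simp [flagWeight, hf, hk, (Nat.lt_succ_self k).trans hk]
  calc ∑ j, (if j ≤ l then flagWeight a j else 0)
      = ∑ j : Fin n, (fun k : ℕ => if k ≤ l then f (k + 1) - f k else 0) j := by
        refine Finset.sum_congr rfl fun j _ => ?_
        simp only [h1, Fin.le_def]
    _ = ∑ k ∈ Finset.range n, (if k ≤ l then f (k + 1) - f k else 0) :=
        Fin.sum_univ_eq_sum_range (fun k : ℕ => if k ≤ l then f (k + 1) - f k else 0) n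
    _ = ∑ k ∈ Finset.range (l + 1), (f (k + 1) - f k) := by
        rw [← Finset.sum_filter]
        refine Finset.sum_congr ?_ fun _ _ => rfl
        ext k
        have := l.2
        simp
        omega
    _ = a l := by
        rw [Finset.sum_range_sub]
        simp [hf]

/-- The columns of index at least `x.2` of the frame number `x.1`. -/
def flagFrame {R : Type*} (T : Fin 3 → Matrix m (Fin n) R) (x : Fin 3 × Fin n) :
    Matrix m {l : Fin n // x.2 ≤ l} R := (T x.1).submatrix id (↑)

theorem flagFrame_conjTranspose_mul_self {T : Fin 3 → Matrix m (Fin n) ℂ} {x : Fin 3 × Fin n}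
    (h : (T x.1)ᴴ * T x.1 = 1) : (flagFrame T x)ᴴ * flagFrame T x = 1 := by
  rw [flagFrame, conjTranspose_submatrix, ← submatrix_mul _ _ _ id _ Function.bijective_id, h,
    submatrix_one _ Subtype.val_injective]

/-- The weights attached to the flags of three spectra. -/
def flagWeights (a : Fin 3 → Fin n → ℝ) (x : Fin 3 × Fin n) : ℝ := flagWeight (a x.1) x.2

omit [Fintype m] in
theorem sum_flagFrame (Y : Fin 3 → Matrix m (Fin n) ℂ) (a : Fin 3 → Fin n → ℝ) :
    ∑ x, (flagWeights a x : ℂ) • (flagFrame Y x * (flagFrame Y x)ᴴ) =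
      ∑ i, frameSum (Y i) (a i) := by
  ext p q
  rw [Fintype.sum_prod_type, Matrix.sum_apply, Matrix.sum_apply]
  refine Finset.sum_congr rfl fun i _ => ?_
  rw [Matrix.sum_apply, frameSum_apply]
  calc ∑ j, ((flagWeights a (i, j) : ℂ) • (flagFrame Y (i, j) * (flagFrame Y (i, j))ᴴ)) p q
      = ∑ j, ∑ l, if j ≤ l then (flagWeight (a i) j : ℂ) * (Y i p l * star (Y i q l)) else 0 := by
        refine Finset.sum_congr rfl fun j _ => ?_
        rw [Matrix.smul_apply, Matrix.mul_apply, smul_eq_mul, Finset.mul_sum, ← Finset.sum_filter,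
          ← Finset.sum_subtype_eq_sum_filter, Finset.subtype_univ]
        rfl
    _ = ∑ l, Y i p l * a i l * star (Y i q l) := by
        rw [Finset.sum_comm]
        refine Finset.sum_congr rfl fun l _ => ?_
        rw [← sum_flagWeight (a i) l]
        push_cast
        rw [Finset.mul_sum, Finset.sum_mul]
        refine Finset.sum_congr rfl fun j _ => ?_
        split_ifs <;> simp; ring

omit [Fintype m] in
theorem mulVec_injective_submatrix_val {A : Matrix m (Fin n) ℂ} (hA : Function.Injective A.mulVec)
    (p : Fin n → Prop) [DecidablePred p] :
    Function.Injective (A.submatrix id (Subtype.val : {l // p l} → Fin n)).mulVec := by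
  rw [mulVec_injective_iff] at hA ⊢
  exact hA.comp _ Subtype.val_injective

end Flags

section IsotropicFrames

variable {n : ℕ}

/-- Triples of orthonormal isotropic frames, the first two being supported in the first and in the
second block respectively. -/
def isotropicFrames (n : ℕ) :
    Set (Fin 3 → Matrix ((Fin n ⊕ Fin n) ⊕ (Fin n ⊕ Fin n)) (Fin n) ℂ) :=
  {Y | (∀ i, (Y i)ᴴ * Y i = 1) ∧ (∀ i, (Y i)ᵀ * Y i = 0) ∧
    (∀ p l, Y 0 (Sum.inr p) l = 0) ∧ ∀ p l, Y 1 (Sum.inl p) l = 0}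

/-- The weighted sum of the projections of a triple of frames has real diagonal blocks. -/
def IsBalanced (a : Fin 3 → Fin n → ℝ)
    (Y : Fin 3 → Matrix ((Fin n ⊕ Fin n) ⊕ (Fin n ⊕ Fin n)) (Fin n) ℂ) : Prop :=
  ∀ p q, p.isLeft = q.isLeft → ((∑ i, frameSum (Y i) (a i)) p q).im = 0

/-- The frames of the normal forms of two summands, together with a third frame. -/
noncomputable def withStandardFrames
    (W : Matrix ((Fin n ⊕ Fin n) ⊕ (Fin n ⊕ Fin n)) (Fin n) ℂ) :
    Fin 3 → Matrix ((Fin n ⊕ Fin n) ⊕ (Fin n ⊕ Fin n)) (Fin n) ℂ :=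
  ![fromRows (isoFrame n)ᴴᵀ 0, fromRows 0 (isoFrame n)ᴴᵀ, W]

theorem conj_conjTranspose_mul_self {m k : Type*} [Fintype m] [DecidableEq k] {u : Matrix m k ℂ}
    (h : uᴴ * u = 1) : uᴴᵀᴴ * uᴴᵀ = 1 := by
  have := congrArg transpose h
  rw [transpose_mul, transpose_one] at this
  rw [← this]
  congr 1
  ext; simp

theorem conj_transpose_mul_self {m k : Type*} [Fintype m] {u : Matrix m k ℂ}
    (h : uᵀ * u = 0) : uᴴᵀᵀ * uᴴᵀ = 0 := by
  have := congrArg conjTranspose h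
  rw [conjTranspose_mul, conjTranspose_zero] at this
  exact this

theorem frameSum_conj {m : Type*} (u : Matrix m (Fin n) ℂ) (a : Fin n → ℝ) (p q : m) :
    frameSum uᴴᵀ a p q = star (frameSum u a p q) := by
  simp [frameSum_apply]

theorem frameSum_apply_eq_zero {m : Type*} {Y : Matrix m (Fin n) ℂ} {p : m}
    (h : ∀ l, Y p l = 0) (a : Fin n → ℝ) (q : m) : frameSum Y a p q = 0 := by
  simp [frameSum_apply, h]

theorem frameSum_isoFrame_im (a : Fin n → ℝ) (p q : Fin n ⊕ Fin n) :
    2 * (frameSum (isoFrame n) a p q).im = (Omega n * normalForm a) p q := by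
  rw [← realFrame_mul_Omega_mul_apply, realFrame_isoFrame]
  simp

theorem withStandardFrames_transpose_mul_self
    {W : Matrix ((Fin n ⊕ Fin n) ⊕ (Fin n ⊕ Fin n)) (Fin n) ℂ} (hW : Wᵀ * W = 0) (i : Fin 3) :
    (withStandardFrames W i)ᵀ * withStandardFrames W i = 0 := by
  have h := conj_transpose_mul_self (isoFrame_transpose_mul_self (n := n))
  fin_cases i
  · simpa [withStandardFrames, transpose_fromRows, fromCols_mul_fromRows] using h
  · simpa [withStandardFrames, transpose_fromRows, fromCols_mul_fromRows] using h
  · exact hW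

theorem withStandardFrames_mem {W : Matrix ((Fin n ⊕ Fin n) ⊕ (Fin n ⊕ Fin n)) (Fin n) ℂ}
    (hW : Wᴴ * W = 1) (hW' : Wᵀ * W = 0) : withStandardFrames W ∈ isotropicFrames n := by
  have h := conj_conjTranspose_mul_self (isoFrame_conjTranspose_mul_self (n := n))
  refine ⟨fun i => ?_, withStandardFrames_transpose_mul_self hW', ?_, ?_⟩
  · fin_cases i
    · simpa [withStandardFrames, conjTranspose_fromRows_eq_fromCols_conjTranspose,
        fromCols_mul_fromRows] using h
    · simpa [withStandardFrames, conjTranspose_fromRows_eq_fromCols_conjTranspose,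
        fromCols_mul_fromRows] using h
    · exact hW
  · intro p l; simp [withStandardFrames]
  · intro p l; simp [withStandardFrames]

theorem FrameCompatible.isBalanced {a b c : Fin n → ℝ} {O} (h : FrameCompatible a b c O) :
    IsBalanced ![a, b, c] (withStandardFrames (O.map Complex.ofReal * isoFrame n)) := by
  obtain ⟨-, h₁, h₂⟩ := h
  have hO : ∀ p q, 2 * (frameSum (O.map Complex.ofReal * isoFrame n) c p q).im =
      (O * (Omega n * normalForm c) * Oᵀ) p q := fun p q => by
    rw [← realFrame_mul_Omega_mul_apply, realFrame_map_mul_isoFrame]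
  have hc : ∀ (a : Fin n → ℝ) p q, 2 * (frameSum (isoFrame n)ᴴᵀ a p q).im =
      -(Omega n * normalForm a) p q := fun a p q => by
    rw [← frameSum_isoFrame_im, frameSum_conj]; simp
  rintro (p | p) (q | q) hpq <;> simp only [Sum.isLeft_inl, Sum.isLeft_inr, reduceCtorEq] at hpq
  all_goals
    rw [Matrix.sum_apply, Fin.sum_univ_three]
    simp only [withStandardFrames, cons_val_zero, cons_val_one, cons_val, Complex.add_im]
  · have e1 := congrFun (congrFun h₁ p) q
    have e2 := hO (Sum.inl p) (Sum.inl q)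
    have e3 := hc a p q
    have e4 := frameSum_apply_eq_zero
      (Y := fromRows (0 : Matrix (Fin n ⊕ Fin n) _ ℂ) (isoFrame n)ᴴᵀ) (p := Sum.inl p) (by simp) b
      (Sum.inl q)
    have e5 : frameSum (fromRows (isoFrame n)ᴴᵀ (0 : Matrix (Fin n ⊕ Fin n) _ ℂ)) a (Sum.inl p)
      (Sum.inl q) =      frameSum (isoFrame n)ᴴᵀ a p q := by simp [frameSum_apply]
    have e6 : (O.toRows₁ * (Omega n * normalForm c) * O.toRows₁ᵀ) p q =
      (O * (Omega n * normalForm c) * Oᵀ) (Sum.inl p) (Sum.inl q) := rfl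
    rw [e4, e5, Complex.zero_im]
    linarith
  · have e1 := congrFun (congrFun h₂ p) q
    have e2 := hO (Sum.inr p) (Sum.inr q)
    have e3 := hc b p q
    have e4 := frameSum_apply_eq_zero
      (Y := fromRows (isoFrame n)ᴴᵀ (0 : Matrix (Fin n ⊕ Fin n) _ ℂ)) (p := Sum.inr p) (by simp) a
      (Sum.inr q)
    have e5 : frameSum (fromRows (0 : Matrix (Fin n ⊕ Fin n) _ ℂ) (isoFrame n)ᴴᵀ) b (Sum.inr p)
      (Sum.inr q) =      frameSum (isoFrame n)ᴴᵀ b p q := by simp [frameSum_apply]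
    have e6 : (O.toRows₂ * (Omega n * normalForm c) * O.toRows₂ᵀ) p q =
      (O * (Omega n * normalForm c) * Oᵀ) (Sum.inr p) (Sum.inr q) := rfl
    rw [e4, e5, Complex.zero_im]
    linarith

theorem exists_orthogonal_intertwiner {u y : Matrix (Fin n ⊕ Fin n) (Fin n) ℂ} (hu : uᴴ * u = 1)
    (hu' : uᵀ * u = 0) {a c : Fin n → ℝ}
    (h : ∀ p q, (frameSum u a p q).im + (frameSum y c p q).im = 0) :
    ∃ O : Matrix (Fin n ⊕ Fin n) (Fin n ⊕ Fin n) ℝ,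
      Oᵀ * O = (realFrame y)ᵀ * realFrame y ∧
      O * (Omega n * normalForm c) * Oᵀ = Omega n * normalForm a := by
  set V := realFrame uᴴᵀ with hV
  have hVV : Vᵀ * V = 1 :=
    realFrame_transpose_mul_self (conj_conjTranspose_mul_self hu) (conj_transpose_mul_self hu')
  have hVV' : V * Vᵀ = 1 := mul_eq_one_comm.mp hVV
  have key : realFrame y * (Omega n * normalForm c) * (realFrame y)ᵀ =
      V * (Omega n * normalForm a) * Vᵀ := by
    ext p q
    rw [realFrame_mul_Omega_mul_apply, hV, realFrame_mul_Omega_mul_apply, frameSum_conj]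
    have := h p q
    simp
    linarith
  refine ⟨Vᵀ * realFrame y, ?_, ?_⟩
  · rw [transpose_mul, transpose_transpose, Matrix.mul_assoc, ← Matrix.mul_assoc V, hVV',
      Matrix.one_mul]
  · calc Vᵀ * realFrame y * (Omega n * normalForm c) * (Vᵀ * realFrame y)ᵀ
        = Vᵀ * (realFrame y * (Omega n * normalForm c) * (realFrame y)ᵀ) * V := by
          simp only [transpose_mul, transpose_transpose, Matrix.mul_assoc]
      _ = (Vᵀ * V) * (Omega n * normalForm a) * (Vᵀ * V) := by
          rw [key]; simp only [Matrix.mul_assoc]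
      _ = _ := by rw [hVV, Matrix.one_mul, Matrix.mul_one]

theorem IsBalanced.exists_frameCompatible {a b c : Fin n → ℝ} {Y} (hY : Y ∈ isotropicFrames n)
    (h : IsBalanced ![a, b, c] Y) : ∃ O, FrameCompatible a b c O := by
  obtain ⟨h1, h2, h3, h4⟩ := hY
  obtain ⟨O₁, e₁, f₁⟩ := exists_orthogonal_intertwiner (u := (Y 0).toRows₁) (y := (Y 2).toRows₁)
    (a := a) (c := c) (by
      rw [← h1 0]; ext i j; simp [Matrix.mul_apply, h3]) (by
      rw [← h2 0]; ext i j; simp [Matrix.mul_apply, h3]) fun p q => by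
      have := h (Sum.inl p) (Sum.inl q) rfl
      rw [Matrix.sum_apply, Fin.sum_univ_three] at this
      simp only [cons_val_zero, cons_val_one, cons_val, Complex.add_im] at this
      rw [frameSum_apply_eq_zero (h4 p), Complex.zero_im, add_zero] at this
      exact this
  obtain ⟨O₂, e₂, f₂⟩ := exists_orthogonal_intertwiner (u := (Y 1).toRows₂) (y := (Y 2).toRows₂)
    (a := b) (c := c) (by
      rw [← h1 1]; ext i j; simp [Matrix.mul_apply, h4]) (by
      rw [← h2 1]; ext i j; simp [Matrix.mul_apply, h4]) fun p q => by
      have := h (Sum.inr p) (Sum.inr q) rfl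
      rw [Matrix.sum_apply, Fin.sum_univ_three] at this
      simp only [cons_val_zero, cons_val_one, cons_val, Complex.add_im] at this
      rw [frameSum_apply_eq_zero (h3 p), Complex.zero_im, zero_add] at this
      exact this
  refine ⟨fromRows O₁ O₂, ?_, f₁, f₂⟩
  rw [transpose_mul_self_eq_toRows, toRows₁_fromRows, toRows₂_fromRows, e₁, e₂,
    ← realFrame_transpose_mul_self (h1 2) (h2 2), transpose_mul_self_eq_toRows (realFrame (Y 2))]
  rfl

theorem IsBalanced.semistable {a : Fin 3 → Fin n → ℝ} (hm : ∀ i, Monotone (a i))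
    (ha : ∀ i j, 0 ≤ a i j) {Y} (hY : Y ∈ isotropicFrames n) (h : IsBalanced a Y) :
    Semistable (flagFrame Y) (flagWeights a) := by
  refine Semistable.of_orthonormal (fun x => flagWeight_nonneg (hm _) (ha _) _)
    (fun x => flagFrame_conjTranspose_mul_self (hY.1 x.1)) ?_
  rw [sum_flagFrame]
  exact h

end IsotropicFrames

section Convexity

variable {n : ℕ}

theorem isCompact_isotropicFrames (n : ℕ) : IsCompact (isotropicFrames n) := by
  have hK := isCompact_univ_pi fun _ : Fin 3 =>
    isCompact_setOf_norm_apply_le (m := (Fin n ⊕ Fin n) ⊕ (Fin n ⊕ Fin n)) (κ := Fin n)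
      (𝕜 := ℂ) 1
  refine hK.of_isClosed_subset ?_ fun Y hY i _ p l =>
    norm_apply_le_one_of_diag (Y i) (fun j => by rw [hY.1, one_apply_eq]) p l
  have hi : ∀ i, Continuous fun Y : Fin 3 →
    Matrix ((Fin n ⊕ Fin n) ⊕ (Fin n ⊕ Fin n)) (Fin n) ℂ => Y i := continuous_apply
  simp only [isotropicFrames, Set.ofPred_and, Set.ofPred_forall]
  refine .inter (isClosed_iInter fun i => ?_) (.inter (isClosed_iInter fun i => ?_)
    (.inter (isClosed_iInter fun p => isClosed_iInter fun l => ?_)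
      (isClosed_iInter fun p => isClosed_iInter fun l => ?_)))
  · exact isClosed_eq ((hi i).matrix_conjTranspose.matrix_mul (hi i)) continuous_const
  · exact isClosed_eq ((hi i).matrix_transpose.matrix_mul (hi i)) continuous_const
  · exact isClosed_eq ((hi 0).matrix_elem _ _) continuous_const
  · exact isClosed_eq ((hi 1).matrix_elem _ _) continuous_const

theorem mul_apply_eq_zero_of_isBD {α k : Type*} [Fintype α] [DecidableEq α]
    {g : Matrix (α ⊕ α) (α ⊕ α) ℂ} (hg : IsBD g) {A : Matrix (α ⊕ α) k ℂ} {b : Bool}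
    (hA : ∀ p l, p.isLeft = b → A p l = 0) (p : α ⊕ α) (l : k) (hp : p.isLeft = b) :
    (g * A) p l = 0 := by
  rw [Matrix.mul_apply]
  refine Finset.sum_eq_zero fun q _ => ?_
  by_cases h : p.isLeft = q.isLeft
  · rw [hA q l (h ▸ hp), mul_zero]
  · rw [(isBD_iff g).mp hg p q h, zero_mul]

theorem mul_apply_eq_zero_of_row {m k l R : Type*} [Fintype k] [Semiring R] {A : Matrix m k R}
    {p : m} (h : ∀ j, A p j = 0) (B : Matrix k l R) (q : l) : (A * B) p q = 0 := by
  simp [Matrix.mul_apply, h]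

theorem Semistable.exists_almost_balanced [NeZero n]
    {T : Fin 3 → Matrix ((Fin n ⊕ Fin n) ⊕ (Fin n ⊕ Fin n)) (Fin n) ℂ} {a : Fin 3 → Fin n → ℝ}
    (hm : ∀ i, Monotone (a i)) (ha : ∀ i j, 0 ≤ a i j)
    (h : Semistable (flagFrame T) (flagWeights a)) (hT : ∀ i, (T i)ᵀ * T i = 0)
    (hinj : ∀ i, Function.Injective (T i).mulVec) (h₀ : ∀ p l, T 0 (Sum.inr p) l = 0)
    (h₁ : ∀ p l, T 1 (Sum.inl p) l = 0) {ε : ℝ} (hε : 0 < ε) :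
    ∃ Y ∈ isotropicFrames n, ∀ p q, p.isLeft = q.isLeft →
      |((∑ i, frameSum (Y i) (a i)) p q).im| ≤ ε := by
  obtain ⟨g, hg, hgY⟩ := h.exists_almost_critical
    (fun x => flagWeight_nonneg (hm _) (ha _) _)
    (fun x => mulVec_injective_submatrix_val (hinj x.1) _) hε
  have hgu : IsUnit g := (isUnit_iff_isUnit_det g).mpr (isUnit_det_of_transpose_mul hg.1)
  have hginj : ∀ i, Function.Injective (g * T i).mulVec := fun i x y hxy => by
    simp only [← mulVec_mulVec] at hxy
    exact hinj i (mulVec_injective_of_isUnit hgu hxy)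
  choose R hR hYY using fun i => exists_lowerTriangular_orthonormal (hginj i)
  set Y := fun i => g * T i * R i with hY
  refine ⟨Y, ⟨hYY, fun i => ?_, fun p l => ?_, fun p l => ?_⟩, ?_⟩
  · calc (Y i)ᵀ * Y i = (R i)ᵀ * ((T i)ᵀ * (gᵀ * g) * T i) * R i := by
          simp only [hY, transpose_mul, Matrix.mul_assoc]
      _ = 0 := by rw [hg.1, Matrix.mul_one, hT, Matrix.mul_zero, Matrix.zero_mul]
  · refine mul_apply_eq_zero_of_row (fun j => ?_) _ _
    refine mul_apply_eq_zero_of_isBD hg.2 (b := false) (fun p l hp => ?_) _ _ rfl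
    rcases p with p | p
    · simp at hp
    · exact h₀ p l
  · refine mul_apply_eq_zero_of_row (fun j => ?_) _ _
    refine mul_apply_eq_zero_of_isBD hg.2 (b := true) (fun p l hp => ?_) _ _ rfl
    rcases p with p | p
    · exact h₁ p l
    · simp at hp
  · rw [← sum_flagFrame]
    refine hgY (flagFrame Y) (fun x => (R x.1).submatrix (↑) (↑)) (fun x => ?_)
      fun x => flagFrame_conjTranspose_mul_self (hYY x.1)
    ext p l
    change _ = ∑ k, (g * T x.1) p k * R x.1 k l
    calc _ = ∑ k : {k // x.2 ≤ k}, (g * T x.1) p k * R x.1 k l := rfl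
      _ = ∑ k, if x.2 ≤ k then (g * T x.1) p k * R x.1 k l else 0 := by
        rw [← Finset.sum_filter, ← Finset.sum_subtype_eq_sum_filter, Finset.subtype_univ]
      _ = ∑ k, (g * T x.1) p k * R x.1 k l := by
        refine Finset.sum_congr rfl fun k _ => ?_
        split_ifs with hk
        · rfl
        · rw [hR x.1 k l ((not_le.mp hk).trans_le l.2), mul_zero]

theorem Semistable.exists_isBalanced [NeZero n]
    {T : Fin 3 → Matrix ((Fin n ⊕ Fin n) ⊕ (Fin n ⊕ Fin n)) (Fin n) ℂ} {a : Fin 3 → Fin n → ℝ}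
    (hm : ∀ i, Monotone (a i)) (ha : ∀ i j, 0 ≤ a i j)
    (h : Semistable (flagFrame T) (flagWeights a)) (hT : ∀ i, (T i)ᵀ * T i = 0)
    (hinj : ∀ i, Function.Injective (T i).mulVec) (h₀ : ∀ p l, T 0 (Sum.inr p) l = 0)
    (h₁ : ∀ p l, T 1 (Sum.inl p) l = 0) :
    ∃ Y ∈ isotropicFrames n, IsBalanced a Y := by
  set defect : (Fin 3 → Matrix ((Fin n ⊕ Fin n) ⊕ (Fin n ⊕ Fin n)) (Fin n) ℂ) → ℝ := fun Y =>
    ∑ p, ∑ q, if p.isLeft = q.isLeft then |((∑ i, frameSum (Y i) (a i)) p q).im| else 0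
  have hcont : Continuous defect := by
    have hf : Continuous fun Y : Fin 3 → Matrix ((Fin n ⊕ Fin n) ⊕ (Fin n ⊕ Fin n)) (Fin n) ℂ =>
        ∑ i, frameSum (Y i) (a i) := by
      refine continuous_finsetSum _ fun i _ => ?_
      have hi : Continuous fun Y : Fin 3 →
        Matrix ((Fin n ⊕ Fin n) ⊕ (Fin n ⊕ Fin n)) (Fin n) ℂ => Y i := continuous_apply i
      exact (hi.matrix_mul continuous_const).matrix_mul hi.matrix_conjTranspose
    refine continuous_finsetSum _ fun p _ => continuous_finsetSum _ fun q _ => ?_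
    split_ifs
    · exact (Complex.continuous_im.comp (hf.matrix_elem p q)).abs
    · exact continuous_const
  have hex := fun ε hε => h.exists_almost_balanced (ε := ε) hm ha hT hinj h₀ h₁ hε
  obtain ⟨Y₁, hY₁, -⟩ := hex 1 one_pos
  obtain ⟨Y, hY, hmin⟩ := (isCompact_isotropicFrames n).exists_isMinOn ⟨Y₁, hY₁⟩
    hcont.continuousOn
  have hle : defect Y ≤ 0 := by
    set N : ℝ := ((Fintype.card ((Fin n ⊕ Fin n) ⊕ (Fin n ⊕ Fin n)) : ℕ) : ℝ) with hN
    have hNpos : 0 < N := Nat.cast_pos.mpr Fintype.card_pos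
    refine le_of_forall_pos_le_add fun δ hδ => ?_
    obtain ⟨Z, hZ, hZδ⟩ := hex (δ / (N * N)) (by positivity)
    refine (isMinOn_iff.mp hmin Z hZ).trans ?_
    calc defect Z ≤ ∑ _p : (Fin n ⊕ Fin n) ⊕ (Fin n ⊕ Fin n),
          ∑ _q : (Fin n ⊕ Fin n) ⊕ (Fin n ⊕ Fin n), δ / (N * N) := by
          refine Finset.sum_le_sum fun p _ => Finset.sum_le_sum fun q _ => ?_
          split_ifs with hpq
          · exact hZδ p q hpq
          · positivity
      _ = 0 + δ := by
          simp only [Finset.sum_const, Finset.card_univ, nsmul_eq_mul, ← hN]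
          field_simp
          ring
  refine ⟨Y, hY, fun p q hpq => ?_⟩
  have hnn : ∀ p q : (Fin n ⊕ Fin n) ⊕ (Fin n ⊕ Fin n),
      0 ≤ if p.isLeft = q.isLeft then |((∑ i, frameSum (Y i) (a i)) p q).im| else 0 := fun p q => by
    split_ifs <;> positivity
  have h1 := (Finset.single_le_sum (fun q _ => hnn p q) (Finset.mem_univ q)).trans
    ((Finset.single_le_sum (fun p _ => Finset.sum_nonneg fun q _ => hnn p q)
      (Finset.mem_univ p)).trans hle)
  rw [if_pos hpq] at h1
  exact abs_nonpos_iff.mp h1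

theorem Semistable.mulVec_injective {α I : Type*} [Fintype α] [DecidableEq α] [Fintype I]
    {κ : I → Type*} [∀ i, Fintype (κ i)] {T : ∀ i, Matrix (α ⊕ α) (κ i) ℂ} {w : I → ℝ}
    (hw : ∀ i, 0 ≤ w i) (h : Semistable T w) {i : I} (hi : 0 < w i) :
    Function.Injective (T i).mulVec := by
  have h0 := h 0 (Matrix.mul_zero _) (by simp [IsBD])
  simp only [sub_zero, Matrix.one_mul, Matrix.mul_zero, rank_zero, add_zero] at h0
  have hle : ∀ j ∈ Finset.univ, w j * ((T j).rank : ℝ) ≤ w j * Fintype.card (κ j) := fun j _ =>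
    mul_le_mul_of_nonneg_left (Nat.cast_le.mpr (rank_le_card_width (T j))) (hw j)
  have heq := (Finset.sum_eq_sum_iff_of_le hle).mp ((Finset.sum_le_sum hle).antisymm h0) i
    (Finset.mem_univ i)
  have hr : (T i).rank = Fintype.card (κ i) := by exact_mod_cast mul_left_cancel₀ hi.ne' heq
  rw [mulVec_injective_iff, linearIndependent_iff_card_eq_finrank_span, ← hr,
    rank_eq_finrank_span_cols]
  rfl

theorem mulVec_injective_of_flagFrame [NeZero n] {m : Type*} {T : Fin 3 → Matrix m (Fin n) ℂ}
    {i : Fin 3} (h : Function.Injective (flagFrame T (i, 0)).mulVec) :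
    Function.Injective (T i).mulVec := by
  rw [mulVec_injective_iff] at h ⊢
  exact h.comp (fun l => ⟨l, Fin.zero_le l⟩) fun _ _ e => congrArg Subtype.val e

end Convexity

section ConvexityOfFrequencies
open Polynomial

variable {n : ℕ}

/-- The standard frames together with a polynomial path of third frames. -/
noncomputable def polynomialFrames
    (P : Matrix ((Fin n ⊕ Fin n) ⊕ (Fin n ⊕ Fin n)) (Fin n ⊕ Fin n) ℂ[X]) :
    Fin 3 → Matrix ((Fin n ⊕ Fin n) ⊕ (Fin n ⊕ Fin n)) (Fin n) ℂ[X] :=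
  ![(fromRows (isoFrame n)ᴴᵀ 0).map C, (fromRows 0 (isoFrame n)ᴴᵀ).map C, P * (isoFrame n).map C]

theorem polynomialFrames_map_eval
    (P : Matrix ((Fin n ⊕ Fin n) ⊕ (Fin n ⊕ Fin n)) (Fin n ⊕ Fin n) ℂ[X]) (z : ℂ) (i : Fin 3) :
    (polynomialFrames P i).map (eval z) =
      withStandardFrames (P.map (eval z) * isoFrame n) i := by
  fin_cases i
  · ext p l
    simp [polynomialFrames, withStandardFrames]
  · ext p l
    simp [polynomialFrames, withStandardFrames]
  · ext p l
    simp [polynomialFrames, withStandardFrames, Matrix.mul_apply, eval_finsetSum]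

theorem FrameCompatible.withStandardFrames_mem {a b c : Fin n → ℝ} {O}
    (h : FrameCompatible a b c O) :
    withStandardFrames (O.map Complex.ofReal * isoFrame n) ∈ isotropicFrames n := by
  have hT : (O.map Complex.ofReal)ᵀ * O.map Complex.ofReal = 1 := by
    rw [← transpose_map]
    exact (Matrix.map_mul (f := Complex.ofRealHom)).symm.trans (by rw [h.1]; simp)
  have hH : (O.map Complex.ofReal)ᴴ = (O.map Complex.ofReal)ᵀ := by
    ext; simp
  refine _root_.withStandardFrames_mem ?_ ?_
  · calc _ = (isoFrame n)ᴴ * ((O.map Complex.ofReal)ᴴ * O.map Complex.ofReal) * isoFrame n := by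
          simp only [conjTranspose_mul, Matrix.mul_assoc]
      _ = 1 := by rw [hH, hT, Matrix.mul_one, isoFrame_conjTranspose_mul_self]
  · calc _ = (isoFrame n)ᵀ * ((O.map Complex.ofReal)ᵀ * O.map Complex.ofReal) * isoFrame n := by
          simp only [transpose_mul, Matrix.mul_assoc]
      _ = 0 := by rw [hT, Matrix.mul_one, isoFrame_transpose_mul_self]

theorem FrameCompatible.exists_linear [NeZero n] {a b c₀ c₁ : Fin n → ℝ} {O₀ O₁}
    (ha : Monotone a) (ha' : ∀ j, 0 < a j) (hb : Monotone b) (hb' : ∀ j, 0 < b j)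
    (hc₀ : Monotone c₀) (hc₀' : ∀ j, 0 < c₀ j) (hc₁ : Monotone c₁) (hc₁' : ∀ j, 0 < c₁ j)
    (h₀ : FrameCompatible a b c₀ O₀) (h₁ : FrameCompatible a b c₁ O₁) {s t : ℝ} (hs : 0 ≤ s)
    (ht : 0 ≤ t) (hst : s + t = 1) (hc : ∀ j, 0 < (s • c₀ + t • c₁) j) :
    ∃ O, FrameCompatible a b (s • c₀ + t • c₁) O := by
  obtain ⟨P, q, hP, hP₀, hP₁⟩ := exists_polynomial_path h₀.1 h₁.1
  have hmono : ∀ {c : Fin n → ℝ}, Monotone c → ∀ i, Monotone ((![a, b, c] : Fin 3 → _) i) :=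
    fun hc i => by fin_cases i <;> assumption
  have hpos : ∀ {c : Fin n → ℝ}, (∀ j, 0 < c j) → ∀ i j, 0 < (![a, b, c] : Fin 3 → _) i j :=
    fun hc i => by fin_cases i <;> assumption
  have hnn : ∀ {c : Fin n → ℝ}, (∀ j, 0 < c j) → ∀ i j, 0 ≤ (![a, b, c] : Fin 3 → _) i j :=
    fun hc i j => (hpos hc i j).le
  have hw : ∀ {c : Fin n → ℝ}, Monotone c → (∀ j, 0 < c j) →
      ∀ x, 0 ≤ flagWeights ![a, b, c] x :=
    fun hc hc' x => flagWeight_nonneg (hmono hc _) (hnn hc' _) _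
  have hstable : ∀ {c O} {z : ℂ}, Monotone c → (∀ j, 0 < c j) → FrameCompatible a b c O →
      P.map (eval z) = O.map Complex.ofReal →
      Semistable (fun x => (flagFrame (polynomialFrames P) x).map (eval z))
        (flagWeights ![a, b, c]) := by
    intro c O z hc hc' h hz
    have := h.isBalanced.semistable (hmono hc) (hnn hc') h.withStandardFrames_mem
    rw [← hz, ← funext (polynomialFrames_map_eval P z)] at this
    exact this
  obtain ⟨z, hz₀, hz₁⟩ := exists_semistable_of_semistable (hw hc₀ hc₀') (hw hc₁ hc₁')
    (hstable hc₀ hc₀' h₀ hP₀) (hstable hc₁ hc₁' h₁ hP₁)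
  set T := withStandardFrames (P.map (eval z) * isoFrame n) with hT
  have hcm : Monotone (s • c₀ + t • c₁) := (hc₀.const_smul hs).add (hc₁.const_smul ht)
  have hw_eq : (fun x => s * flagWeights ![a, b, c₀] x + t * flagWeights ![a, b, c₁] x) =
      flagWeights ![a, b, s • c₀ + t • c₁] := by
    funext ⟨i, j⟩
    simp only [flagWeights, ← flagWeight_add_smul]
    congr 1
    fin_cases i
    · simp [← add_smul, hst]
    · simp [← add_smul, hst]
    · rfl
  have hlin : Semistable (flagFrame T) (flagWeights ![a, b, s • c₀ + t • c₁]) := by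
    have := hz₀.linear hz₁ hs ht
    rw [hw_eq] at this
    rw [hT, ← funext (polynomialFrames_map_eval P z)]
    exact this
  have hPz : (P.map (eval z))ᵀ * P.map (eval z) = eval z q • 1 := by
    have := congrArg (fun M => M.map (eval z)) hP
    ext i j
    have hij := congrFun (congrFun this i) j
    simp only [map_apply, Matrix.mul_apply, eval_finsetSum, eval_mul, transpose_apply,
      Matrix.smul_apply, smul_eq_mul, one_apply, mul_ite, mul_one, mul_zero] at hij ⊢
    rw [hij]
    split_ifs <;> simp
  obtain ⟨Y, hY, hYb⟩ := hlin.exists_isBalanced (hmono hcm) (hnn hc)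
    (withStandardFrames_transpose_mul_self (by
      calc _ = (isoFrame n)ᵀ * ((P.map (eval z))ᵀ * P.map (eval z)) * isoFrame n := by
            simp only [transpose_mul, Matrix.mul_assoc]
        _ = 0 := by simp [hPz, isoFrame_transpose_mul_self]))
    (fun i => mulVec_injective_of_flagFrame <| hlin.mulVec_injective (hw hcm hc) <| by
      simpa [flagWeights, flagWeight] using hpos hc i 0)
    (fun p l => by simp [hT, withStandardFrames]) (fun p l => by simp [hT, withStandardFrames])
  exact hYb.exists_frameCompatible hY

theorem convex_setOf_monotone_frameCompatible {a b : Fin n → ℝ}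
    (ha : Monotone a) (ha' : ∀ j, 0 < a j) (hb : Monotone b) (hb' : ∀ j, 0 < b j) :
    Convex ℝ {c : Fin n → ℝ | Monotone c ∧ (∀ j, 0 ≤ c j) ∧ ∃ O, FrameCompatible a b c O} := by
  rcases eq_or_ne n 0 with rfl | hn
  · exact Set.subsingleton_of_subsingleton.convex
  have : NeZero n := ⟨hn⟩
  rintro c₀ ⟨hc₀, hc₀', O₀, h₀⟩ c₁ ⟨hc₁, hc₁', O₁, h₁⟩ s t hs ht hst
  have hp₀ : ∀ j, 0 < c₀ j := fun j => (hc₀' j).lt_of_ne' (h₀.ne_zero ha' j)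
  have hp₁ : ∀ j, 0 < c₁ j := fun j => (hc₁' j).lt_of_ne' (h₁.ne_zero ha' j)
  have hc : ∀ j, 0 < (s • c₀ + t • c₁) j := fun j =>
    (convex_Ioi (0 : ℝ)) (hp₀ j) (hp₁ j) hs ht hst
  exact ⟨(hc₀.const_smul hs).add (hc₁.const_smul ht), fun j => (hc j).le,
    h₀.exists_linear ha ha' hb hb' hc₀ hp₀ hc₁ hp₁ h₁ hs ht hst hc⟩

end ConvexityOfFrequencies

end Williamson

/-- Given nondecreasing positive frequency tuples `λ` and `μ`, the
set of all (nondecreasing, positive) frequency tuples `F(H₁ + H₂)` where `H₁`, `H₂`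
are symmetric positive definite with `F(H₁) = λ` and `F(H₂) = μ` is a closed convex
subset of `ℝⁿ`. -/
theorem frequencies_of_sums_closed_convex (n : ℕ) (lam mu : Fin n → ℝ)
    (hlam_mono : Monotone lam) (hmu_mono : Monotone mu)
    (hlam_pos : ∀ j, 0 < lam j) (hmu_pos : ∀ j, 0 < mu j) :
    IsClosed {nu : Fin n → ℝ | Monotone nu ∧ (∀ j, 0 < nu j) ∧
        ∃ H₁ H₂ : Matrix (Fin n ⊕ Fin n) (Fin n ⊕ Fin n) ℝ,
          H₁.PosDef ∧ H₂.PosDef ∧ hasFrequencies n H₁ lam ∧ hasFrequencies n H₂ mu ∧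
            hasFrequencies n (H₁ + H₂) nu} ∧
      Convex ℝ {nu : Fin n → ℝ | Monotone nu ∧ (∀ j, 0 < nu j) ∧
        ∃ H₁ H₂ : Matrix (Fin n ⊕ Fin n) (Fin n ⊕ Fin n) ℝ,
          H₁.PosDef ∧ H₂.PosDef ∧ hasFrequencies n H₁ lam ∧ hasFrequencies n H₂ mu ∧
            hasFrequencies n (H₁ + H₂) nu} := by
  rw [setOf_frequencies_eq hlam_pos hmu_pos]
  exact ⟨isClosed_setOf_monotone_frameCompatible lam mu,
    convex_setOf_monotone_frameCompatible hlam_mono hlam_pos hmu_mono hmu_pos⟩
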